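/- arXiv:hep-th/9403178 — 3 statements merged into one kernel-verified Lean document; each statement's English description precedes it below -/
import Mathlib

section
/- Let D ⊆ ℂ be an open disc centered at 0, let f be meromorphic on D such that z ↦ f(z) − 1/z extends holomorphically to D with value 0 at z = 0, and suppose f satisfies the addition theorem f(x+y) = (f(x)f′(y) − f(y)f′(x)) / (f(x)² − f(y)²) for all x, y ∈ D ∖ {0} with x + y ∈ D ∖ {0} at which f is analytic and f(x)² ≠ f(y)². Let g be meromorphic on D ∖ {0}, not identically zero, with g′(x) = −f(x) g(x) for all x ∈ D ∖ {0} at which f and g are analytic. Then (f, g) is a non-trivial solution of the B₂ functional equation. -/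
/-!
STATEMENT 11: If `f` is as in the addition theorem (normalized
`f(z) = 1/z + O(z)`) and `g` is meromorphic, not identically zero, with
`g′ = −f g`, then `(f, g)` is a non-trivial solution of the `B₂` functional
equation.
-/

/-- The punctured open disc of radius `r` around `0` in `ℂ`. -/
def PDisc (r : ℝ) : Set ℂ := Metric.ball (0 : ℂ) r \ {0}

/-- The pair `(f, g)` satisfies the `B₂` functional equation on the punctured
disc of radius `r`:
`f(x)(g(x+y) + g(x−y)) + f(y)(g(x+y) − g(x−y)) = 0`
whenever `x, y, x+y, x−y` lie in the punctured disc, `f` is analytic at `x`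
and `y`, and `g` is analytic at `x+y` and `x−y`. -/
def B2FE (r : ℝ) (f g : ℂ → ℂ) : Prop :=
  ∀ x y : ℂ, x ∈ PDisc r → y ∈ PDisc r → x + y ∈ PDisc r → x - y ∈ PDisc r →
    AnalyticAt ℂ f x → AnalyticAt ℂ f y →
    AnalyticAt ℂ g (x + y) → AnalyticAt ℂ g (x - y) →
    f x * (g (x + y) + g (x - y)) + f y * (g (x + y) - g (x - y)) = 0

open Filter Topology in
lemma preconn_ball_diff {r : ℝ} (hr : 0 < r) {s : Set ℂ} (hs : s.Countable) :
    IsPreconnected (Metric.ball (0 : ℂ) r \ s) := by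
  set e := OpenPartialHomeomorph.univBall (0 : ℂ) r with he
  have hsrc : e.source = Set.univ := OpenPartialHomeomorph.univBall_source 0 r
  have htgt : e.target = Metric.ball 0 r := OpenPartialHomeomorph.univBall_target 0 hr
  have hinj : Set.InjOn e Set.univ := hsrc ▸ e.injOn
  have hc : (e ⁻¹' s).Countable := hs.preimage_of_injOn (hinj.mono (Set.subset_univ _))
  have h1 : IsPreconnected ((e ⁻¹' s)ᶜ) :=
    (hc.isConnected_compl_of_one_lt_rank (by simp)).isPreconnected
  have hcont : ContinuousOn e Set.univ := hsrc ▸ e.continuousOn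
  have h2 := h1.image e (hcont.mono (Set.subset_univ _))
  convert h2 using 1
  ext z
  constructor
  · rintro ⟨hz, hzs⟩
    rw [← htgt] at hz
    exact ⟨e.symm z, by simp only [Set.mem_compl_iff, Set.mem_preimage, e.right_inv hz]; exact hzs,
      e.right_inv hz⟩
  · rintro ⟨w, hw, rfl⟩
    exact ⟨htgt ▸ e.map_source (hsrc ▸ Set.mem_univ w), hw⟩

lemma isOpen_PDisc (r : ℝ) : IsOpen (PDisc r) := Metric.isOpen_ball.sdiff isClosed_singleton

lemma neg_mem_PDisc {r : ℝ} {z : ℂ} (hz : z ∈ PDisc r) : -z ∈ PDisc r := by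
  simpa [PDisc] using hz

/-- A solution of `g' = - f g` is a constant multiple of `exp (-H) / z`. -/
lemma g_form {r : ℝ} (hr : 0 < r) {f g h H : ℂ → ℂ}
    (hf : ∀ z ∈ PDisc r, f z = 1 / z + h z)
    (hfan : ∀ z ∈ PDisc r, AnalyticAt ℂ f z)
    (hH : ∀ z ∈ Metric.ball (0 : ℂ) r, HasDerivAt H (h z) z)
    (hgmer : MeromorphicOn g (PDisc r))
    (hlog : ∀ x ∈ PDisc r, AnalyticAt ℂ f x → AnalyticAt ℂ g x →
      deriv g x = -(f x) * g x) :
    ∃ C : ℂ, ∀ z ∈ PDisc r, AnalyticAt ℂ g z → g z = C * (Complex.exp (-H z) / z) := by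
  set S : Set ℂ := PDisc r ∩ {z | AnalyticAt ℂ g z} with hS
  have hSo : IsOpen S := (isOpen_PDisc r).inter (isOpen_analyticAt ℂ g)
  have hc : ({z | AnalyticAt ℂ g z}ᶜ ∩ PDisc r ∪ {0}).Countable :=
    hgmer.countable_compl_analyticAt_inter.union (Set.countable_singleton 0)
  have hSp : IsPreconnected S := by
    convert preconn_ball_diff hr hc using 1
    ext z
    simp only [hS, PDisc, Set.mem_inter_iff, Set.mem_sdiff, Set.mem_union, Set.mem_compl_iff,
      Set.mem_ofPred_eq, Set.mem_singleton_iff]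
    tauto
  have hd : ∀ z ∈ S, HasDerivAt (fun z => z * g z * Complex.exp (H z)) 0 z := by
    rintro z ⟨hz, hgz⟩
    have hz0 : z ≠ 0 := hz.2
    have h1 := hgz.differentiableAt.hasDerivAt
    rw [hlog z hz (hfan z hz) hgz, hf z hz] at h1
    refine (((hasDerivAt_id z).mul h1).mul (hH z hz.1).cexp).congr_deriv ?_
    simp only [id, Pi.mul_apply]
    field_simp
    ring
  obtain ⟨C, hC⟩ := hSo.exists_is_const_of_deriv_eq_zero hSp
    (fun z hz => (hd z hz).differentiableAt.differentiableWithinAt)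
    (fun z hz => (hd z hz).deriv)
  refine ⟨C, fun z hz hgz => ?_⟩
  have hz0 : z ≠ 0 := hz.2
  have := hC z ⟨hz, hgz⟩
  rw [← this, Complex.exp_neg]
  field_simp

open Filter Topology in
lemma sq_even {r : ℝ} {f h : ℂ → ℂ}
    (hr : 0 < r)
    (hh : ∀ z ∈ Metric.ball (0 : ℂ) r, AnalyticAt ℂ h z)
    (hf : ∀ z ∈ PDisc r, f z = 1 / z + h z)
    (hfan : ∀ z ∈ PDisc r, AnalyticAt ℂ f z)
    (hadd : ∀ x y : ℂ, x ∈ PDisc r → y ∈ PDisc r → x + y ∈ PDisc r → f x ^ 2 ≠ f y ^ 2 →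
      f (x + y) = (f x * deriv f y - f y * deriv f x) / (f x ^ 2 - f y ^ 2))
    (y : ℂ) (hy : y ∈ PDisc r) : f (-y) ^ 2 = f y ^ 2 := by
  by_contra hne
  have hny := neg_mem_PDisc hy
  have hc : ContinuousAt f (-y) := (hfan _ hny).continuousAt
  have hc' : ContinuousAt (deriv f) (-y) := (hfan _ hny).deriv.continuousAt
  have ht : Tendsto (fun x : ℂ => x + y) (𝓝 (-y)) (𝓝 0) := by
    have : Continuous fun x : ℂ => x + y := by fun_prop
    simpa using this.tendsto (-y)
  have h0 : (0 : ℂ) ∈ Metric.ball (0 : ℂ) r := Metric.mem_ball_self hr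
  have hcD : ContinuousAt (fun x => f x ^ 2 - f y ^ 2) (-y) := by fun_prop
  have hD : ∀ᶠ x in 𝓝 (-y), f x ^ 2 - f y ^ 2 ≠ 0 := hcD.eventually_ne (sub_ne_zero.2 hne)
  have hT1 : Tendsto (fun x => 1 + (x + y) * h (x + y)) (𝓝 (-y)) (𝓝 1) := by
    have := (tendsto_const_nhds (x := (1:ℂ))).add (ht.mul ((hh 0 h0).continuousAt.tendsto.comp ht))
    simpa using this
  have hT2 : Tendsto (fun x => (x + y) *
      ((f x * deriv f y - f y * deriv f x) / (f x ^ 2 - f y ^ 2))) (𝓝 (-y)) (𝓝 0) := by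
    have h3 : ContinuousAt (fun x => (f x * deriv f y - f y * deriv f x) / (f x ^ 2 - f y ^ 2))
        (-y) := ContinuousAt.div (by fun_prop) hcD (sub_ne_zero.2 hne)
    simpa using ht.mul h3.tendsto
  have heq : (fun x => 1 + (x + y) * h (x + y)) =ᶠ[𝓝[≠] (-y)] (fun x => (x + y) *
      ((f x * deriv f y - f y * deriv f x) / (f x ^ 2 - f y ^ 2))) := by
    filter_upwards [nhdsWithin_le_nhds hD, nhdsWithin_le_nhds ((isOpen_PDisc r).mem_nhds hny),
      nhdsWithin_le_nhds (ht.eventually (Metric.isOpen_ball.mem_nhds h0)), self_mem_nhdsWithin]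
      with x h1 h2 h3 h4
    have hxy : x + y ≠ 0 := fun h => h4 (eq_neg_of_add_eq_zero_left h)
    have hm : x + y ∈ PDisc r := ⟨h3, hxy⟩
    rw [← hadd x y h2 hy hm (sub_ne_zero.1 h1), hf _ hm]
    field_simp
  have := tendsto_nhds_unique ((hT1.mono_left nhdsWithin_le_nhds).congr' heq)
    (hT2.mono_left nhdsWithin_le_nhds)
  exact one_ne_zero this

open Filter Topology in
lemma h_odd {r : ℝ} {f h : ℂ → ℂ}
    (hr : 0 < r)
    (hh : ∀ z ∈ Metric.ball (0 : ℂ) r, AnalyticAt ℂ h z)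
    (hf : ∀ z ∈ PDisc r, f z = 1 / z + h z)
    (hsq : ∀ y ∈ PDisc r, f (-y) ^ 2 = f y ^ 2) :
    ∀ z ∈ Metric.ball (0 : ℂ) r, h (-z) = - h z := by
  have h0 : (0 : ℂ) ∈ Metric.ball (0 : ℂ) r := Metric.mem_ball_self hr
  have hneg : ∀ z ∈ Metric.ball (0 : ℂ) r, -z ∈ Metric.ball (0 : ℂ) r := by
    intro z hz; simpa using hz
  have hcomp : ∀ z ∈ Metric.ball (0 : ℂ) r, AnalyticAt ℂ (fun z => h (-z)) z := fun z hz =>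
    AnalyticAt.fun_comp (hh _ (hneg z hz)) (by fun_prop)
  have hA : AnalyticOnNhd ℂ (fun z => h (-z) + h z) (Metric.ball (0 : ℂ) r) := fun z hz =>
    (hcomp z hz).add (hh z hz)
  have hev : ∀ᶠ z in 𝓝[≠] (0 : ℂ), h (-z) + h z = 0 := by
    have hc : ContinuousAt (fun z : ℂ => 2 + z * h z - z * h (-z)) 0 := by
      have c1 := (hh 0 h0).continuousAt
      have c2 := (hcomp 0 h0).continuousAt
      exact (continuousAt_const.add (continuousAt_id.mul c1)).sub (continuousAt_id.mul c2)
    have hne : ∀ᶠ z in 𝓝 (0 : ℂ), 2 + z * h z - z * h (-z) ≠ 0 :=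
      hc.eventually_ne (by simp)
    filter_upwards [nhdsWithin_le_nhds hne, nhdsWithin_le_nhds (Metric.isOpen_ball.mem_nhds h0),
      self_mem_nhdsWithin] with z h1 h2 h3
    have hz0 : z ≠ 0 := h3
    have hm : z ∈ PDisc r := ⟨h2, h3⟩
    have h4 := hsq z hm
    rw [hf z hm, hf _ (neg_mem_PDisc hm)] at h4
    have h5 : (h (-z) + h z) * (2 + z * h z - z * h (-z)) = 0 := by
      field_simp at h4
      have h6 : z * ((h (-z) + h z) * (2 + z * h z - z * h (-z))) = 0 := by
        linear_combination -h4
      exact (mul_eq_zero.1 h6).resolve_left hz0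
    exact (mul_eq_zero.1 h5).resolve_right h1
  intro z hz
  have := hA.eqOn_zero_of_preconnected_of_frequently_eq_zero
    (Metric.isPreconnected_ball) h0 hev.frequently hz
  exact eq_neg_of_add_eq_zero_left this

open Filter Topology in
/-- The core identity for `g₀ = exp (-H) / z`. -/
lemma core {r : ℝ} {f h H : ℂ → ℂ}
    (hr : 0 < r)
    (hh : ∀ z ∈ Metric.ball (0 : ℂ) r, AnalyticAt ℂ h z)
    (hf : ∀ z ∈ PDisc r, f z = 1 / z + h z)
    (hfan : ∀ z ∈ PDisc r, AnalyticAt ℂ f z)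
    (hadd : ∀ x y : ℂ, x ∈ PDisc r → y ∈ PDisc r → x + y ∈ PDisc r → f x ^ 2 ≠ f y ^ 2 →
      f (x + y) = (f x * deriv f y - f y * deriv f x) / (f x ^ 2 - f y ^ 2))
    (hodd : ∀ y ∈ PDisc r, f (-y) = - f y)
    (hH : ∀ z ∈ Metric.ball (0 : ℂ) r, HasDerivAt H (h z) z)
    (hHeven : ∀ z ∈ Metric.ball (0 : ℂ) r, H (-z) = H z)
    (x y : ℂ) (hx : x ∈ PDisc r) (hy : y ∈ PDisc r) (hxy : x + y ∈ PDisc r)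
    (hxy' : x - y ∈ PDisc r) :
    (f x + f y) * (Complex.exp (-H (x + y)) / (x + y))
      + (f x - f y) * (Complex.exp (-H (x - y)) / (x - y)) = 0 := by
  have h0 : (0 : ℂ) ∈ Metric.ball (0 : ℂ) r := Metric.mem_ball_self hr
  have hy0 : y ≠ 0 := hy.2
  have hny := neg_mem_PDisc hy
  have hHan : ∀ z ∈ Metric.ball (0 : ℂ) r, AnalyticAt ℂ H z := fun z hz =>
    DifferentiableOn.analyticAt (s := Metric.ball (0 : ℂ) r)
      (fun w hw => (hH w hw).differentiableAt.differentiableWithinAt)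
      (Metric.isOpen_ball.mem_nhds hz)
  -- the derivative of `f` is even
  have hdy : deriv f (-y) = deriv f y := by
    have h1 : (fun z => f (-z)) =ᶠ[𝓝 y] fun z => - f z := by
      filter_upwards [(isOpen_PDisc r).mem_nhds hy] with z hz using hodd z hz
    have h2 := h1.deriv_eq
    rw [deriv_comp_neg, deriv.fun_neg] at h2
    exact neg_injective h2
  set g0 : ℂ → ℂ := fun z => Complex.exp (-H z) / z with hg0
  have hg0d : ∀ z ∈ PDisc r, HasDerivAt g0 (-(f z) * g0 z) z := by
    intro z hz
    have hz0 : z ≠ 0 := hz.2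
    refine (((hH z hz.1).neg.cexp).div (hasDerivAt_id z) hz0).congr_deriv ?_
    simp only [hg0, hf z hz, id, Pi.neg_apply]
    field_simp
    ring
  have hg0ne : ∀ z ∈ PDisc r, g0 z ≠ 0 := fun z hz =>
    div_ne_zero (Complex.exp_ne_zero _) hz.2
  have htp : Tendsto (fun x : ℂ => x + y) (𝓝 0) (𝓝 y) := by
    have : Continuous fun x : ℂ => x + y := by fun_prop
    simpa using this.tendsto 0
  have htm : Tendsto (fun x : ℂ => x - y) (𝓝 0) (𝓝 (-y)) := by
    have : Continuous fun x : ℂ => x - y := by fun_prop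
    simpa using this.tendsto 0
  have hch : ContinuousAt h 0 := (hh 0 h0).continuousAt
  have hpl : Tendsto (fun x => 1 + x * h x + x * f y) (𝓝 0) (𝓝 1) := by
    have : ContinuousAt (fun x => 1 + x * h x + x * f y) 0 := by fun_prop
    simpa [ContinuousAt] using this
  have hmi : Tendsto (fun x => 1 + x * h x - x * f y) (𝓝 0) (𝓝 1) := by
    have : ContinuousAt (fun x => 1 + x * h x - x * f y) 0 := by fun_prop
    simpa [ContinuousAt] using this
  -- good punctured neighbourhood
  have hgood : ∀ᶠ x in 𝓝 (0 : ℂ), x ∈ Metric.ball (0 : ℂ) r ∧ x + y ∈ PDisc r ∧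
      x - y ∈ PDisc r ∧ 1 + x * h x + x * f y ≠ 0 ∧ 1 + x * h x - x * f y ≠ 0 := by
    filter_upwards [Metric.isOpen_ball.mem_nhds h0,
      htp.eventually ((isOpen_PDisc r).mem_nhds hy),
      htm.eventually ((isOpen_PDisc r).mem_nhds hny),
      hpl.eventually_ne one_ne_zero, hmi.eventually_ne one_ne_zero] with x a b c d e
    exact ⟨a, b, c, d, e⟩
  obtain ⟨ε, hε, hball⟩ := Metric.eventually_nhds_iff_ball.1 hgood
  set T : Set ℂ := Metric.ball (0 : ℂ) ε \ {0} with hT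
  have hTo : IsOpen T := Metric.isOpen_ball.sdiff isClosed_singleton
  have hTp : IsPreconnected T := preconn_ball_diff hε (Set.countable_singleton 0)
  have hTf : ∀ x ∈ T, f x + f y ≠ 0 ∧ f x - f y ≠ 0 := by
    intro x hx
    have hx0 : x ≠ 0 := hx.2
    obtain ⟨a, -, -, d, e⟩ := hball x hx.1
    rw [hf x ⟨a, hx.2⟩]
    constructor
    · intro h; apply d; field_simp at h; linear_combination h
    · intro h; apply e; field_simp at h; linear_combination h
  set R : ℂ → ℂ := fun x => ((f x + f y) * g0 (x + y)) / ((f x - f y) * g0 (x - y)) with hR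
  have hRd : ∀ x ∈ T, HasDerivAt R 0 x := by
    intro x hx
    obtain ⟨a, b, c, -, -⟩ := hball x hx.1
    obtain ⟨hp, hm⟩ := hTf x hx
    have hxP : x ∈ PDisc r := ⟨a, hx.2⟩
    have hne : f x ^ 2 - f y ^ 2 ≠ 0 := by
      rw [sq_sub_sq]; exact mul_ne_zero hp hm
    have e1 := hadd x y hxP hy b (sub_ne_zero.1 hne)
    have e2 := hadd x (-y) hxP hny (by rwa [← sub_eq_add_neg])
      (by rw [hodd y hy, neg_sq]; exact sub_ne_zero.1 hne)
    rw [hodd y hy, hdy, neg_sq, ← sub_eq_add_neg] at e2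
    have d0 := (hfan x hxP).differentiableAt.hasDerivAt
    have d1 := (hg0d _ b).comp_add_const x y
    have d2 := (hg0d _ c).comp_sub_const x y
    have n1 := hg0ne _ b
    have n2 := hg0ne _ c
    refine (((d0.add_const (f y)).mul d1).div ((d0.sub_const (f y)).mul d2)
      (mul_ne_zero hm n2)).congr_deriv ?_
    simp only [Pi.mul_apply]
    rw [e1, e2, div_eq_zero_iff]
    left
    field_simp
    ring
  obtain ⟨c, hc⟩ := hTo.exists_is_const_of_deriv_eq_zero hTp
    (fun z hz => (hRd z hz).differentiableAt.differentiableWithinAt)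
    (fun z hz => (hRd z hz).deriv)
  have hTn : T ∈ 𝓝[≠] (0 : ℂ) :=
    sdiff_mem_nhdsWithin_compl (Metric.isOpen_ball.mem_nhds (Metric.mem_ball_self hε)) _
  have hgodd : g0 (-y) = - g0 y := by
    simp only [hg0, hHeven y hy.1, div_neg]
  have hlim : Tendsto (fun x => ((1 + x * h x + x * f y) * g0 (x + y)) /
      ((1 + x * h x - x * f y) * g0 (x - y))) (𝓝 0) (𝓝 (-1)) := by
    have := (hpl.mul ((hg0d y hy).continuousAt.tendsto.comp htp)).div
      (hmi.mul ((hg0d _ hny).continuousAt.tendsto.comp htm))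
      (by simpa using hg0ne _ hny)
    have hval : (1 * g0 y) / (1 * g0 (-y)) = -1 := by
      rw [hgodd]; have := hg0ne y hy; field_simp
    rw [hval] at this
    exact this
  have hcv : c = -1 := by
    refine tendsto_nhds_unique (f := fun _ : ℂ => c) (l := 𝓝[≠] (0:ℂ)) tendsto_const_nhds
      ((hlim.mono_left nhdsWithin_le_nhds).congr' ?_)
    filter_upwards [hTn] with x hx
    obtain ⟨a, b, c', d, e⟩ := hball x hx.1
    have hx0 : x ≠ 0 := hx.2
    rw [← hc x hx]
    simp only [hR]
    rw [hf x ⟨a, hx.2⟩]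
    rw [← mul_div_mul_left ((1 / x + h x + f y) * g0 (x + y)) _ hx0]
    congr 1 <;> field_simp
  -- the regularized function
  set Φ : ℂ → ℂ := fun x => (1 + x * h x + x * f y) * ((x - y) * Complex.exp (-H (x + y)))
    + (1 + x * h x - x * f y) * ((x + y) * Complex.exp (-H (x - y))) with hΦ
  have key : ∀ x, x ≠ 0 → x + y ≠ 0 → x - y ≠ 0 → x ∈ Metric.ball (0 : ℂ) r →
      Φ x = x * (x + y) * (x - y) *
        ((f x + f y) * g0 (x + y) + (f x - f y) * g0 (x - y)) := by
    intro x h1 h2 h3 h4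
    simp only [hΦ, hg0]
    rw [hf x ⟨h4, h1⟩]
    field_simp
  set U : Set ℂ := (fun x => x + y) ⁻¹' Metric.ball (0 : ℂ) r ∩
    (fun x => x - y) ⁻¹' Metric.ball (0 : ℂ) r with hU
  have hUb : ∀ x ∈ U, x ∈ Metric.ball (0 : ℂ) r := by
    rintro x ⟨h1, h2⟩
    simp only [Set.mem_preimage, mem_ball_zero_iff] at h1 h2 ⊢
    have h3 : ‖(2 : ℂ) * x‖ ≤ ‖x + y‖ + ‖x - y‖ := by
      refine le_trans (le_of_eq ?_) (norm_add_le _ _)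
      congr 1; ring
    rw [norm_mul, Complex.norm_ofNat] at h3
    linarith
  have hUp : IsPreconnected U := by
    have hU2 : U = Metric.ball (-y) r ∩ Metric.ball y r := by
      ext z; simp [hU, dist_eq_norm]
    rw [hU2]
    exact ((convex_ball _ _).inter (convex_ball _ _)).isPreconnected
  have hΦan : AnalyticOnNhd ℂ Φ U := by
    intro x hx
    have a1 := hh x (hUb x hx)
    have a2 : AnalyticAt ℂ (fun x => H (x + y)) x :=
      AnalyticAt.fun_comp (hHan _ hx.1) (by fun_prop)
    have a3 : AnalyticAt ℂ (fun x => H (x - y)) x :=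
      AnalyticAt.fun_comp (hHan _ hx.2) (by fun_prop)
    exact ((analyticAt_const.add (analyticAt_id.mul a1)).add
        (analyticAt_id.mul analyticAt_const)).mul
        ((analyticAt_id.sub analyticAt_const).mul a2.neg.cexp) |>.add
      (((analyticAt_const.add (analyticAt_id.mul a1)).sub
        (analyticAt_id.mul analyticAt_const)).mul
        ((analyticAt_id.add analyticAt_const).mul a3.neg.cexp))
  have hΦ0 : ∀ᶠ x in 𝓝[≠] (0 : ℂ), Φ x = 0 := by
    filter_upwards [hTn] with x hx
    obtain ⟨a, b, c', d, e⟩ := hball x hx.1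
    rw [key x hx.2 b.2 c'.2 a]
    have h1 := hc x hx
    rw [hcv] at h1
    simp only [hR] at h1
    rw [div_eq_iff (mul_ne_zero (hTf x hx).2 (hg0ne _ c'))] at h1
    rw [h1]; ring
  have h0U : (0 : ℂ) ∈ U := by
    have := hy.1
    simpa [hU] using this
  have hfin := hΦan.eqOn_zero_of_preconnected_of_frequently_eq_zero hUp h0U hΦ0.frequently
    (show x ∈ U from ⟨hxy.1, hxy'.1⟩)
  rw [key x hx.2 hxy.2 hxy'.2 hx.1] at hfin
  exact (mul_eq_zero.1 hfin).resolve_left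
    (mul_ne_zero (mul_ne_zero hx.2 hxy.2) hxy'.2)

theorem addition_theorem_gives_b2_solution
    (r : ℝ) (hr : 0 < r) (f g : ℂ → ℂ)
    (hmer : MeromorphicOn f (Metric.ball (0 : ℂ) r))
    (hpole : ∃ h : ℂ → ℂ, (∀ z ∈ Metric.ball (0 : ℂ) r, AnalyticAt ℂ h z) ∧ h 0 = 0 ∧
      ∀ z ∈ Metric.ball (0 : ℂ) r, z ≠ 0 → f z = 1 / z + h z)
    (hadd : ∀ x y : ℂ, x ∈ Metric.ball (0 : ℂ) r → y ∈ Metric.ball (0 : ℂ) r →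
      x + y ∈ Metric.ball (0 : ℂ) r → x ≠ 0 → y ≠ 0 → x + y ≠ 0 →
      AnalyticAt ℂ f x → AnalyticAt ℂ f y → AnalyticAt ℂ f (x + y) →
      f x ^ 2 ≠ f y ^ 2 →
      f (x + y) = (f x * deriv f y - f y * deriv f x) / (f x ^ 2 - f y ^ 2))
    (hgmer : MeromorphicOn g (PDisc r))
    (hgne : ∃ z ∈ PDisc r, AnalyticAt ℂ g z ∧ g z ≠ 0)
    (hlog : ∀ x ∈ PDisc r, AnalyticAt ℂ f x → AnalyticAt ℂ g x →
      deriv g x = -(f x) * g x) :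
    B2FE r f g ∧
      (∃ z ∈ PDisc r, AnalyticAt ℂ f z ∧ f z ≠ 0) ∧
      (∃ z ∈ PDisc r, AnalyticAt ℂ g z ∧ g z ≠ 0) := by
  obtain ⟨h, hh, h00, hfh⟩ := hpole
  have h0 : (0 : ℂ) ∈ Metric.ball (0 : ℂ) r := Metric.mem_ball_self hr
  have hf : ∀ z ∈ PDisc r, f z = 1 / z + h z := fun z hz => hfh z hz.1 hz.2
  have hfan : ∀ z ∈ PDisc r, AnalyticAt ℂ f z := by
    intro z hz
    have hz0 : z ≠ 0 := hz.2
    have h1 : AnalyticAt ℂ (fun z => 1 / z + h z) z :=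
      (analyticAt_const.div analyticAt_id hz0).add (hh z hz.1)
    refine h1.congr ?_
    filter_upwards [(isOpen_PDisc r).mem_nhds hz] with w hw using (hf w hw).symm
  have hadd' : ∀ x y : ℂ, x ∈ PDisc r → y ∈ PDisc r → x + y ∈ PDisc r → f x ^ 2 ≠ f y ^ 2 →
      f (x + y) = (f x * deriv f y - f y * deriv f x) / (f x ^ 2 - f y ^ 2) :=
    fun x y hx hy hxy hne => hadd x y hx.1 hy.1 hxy.1 hx.2 hy.2 hxy.2 (hfan x hx) (hfan y hy)
      (hfan _ hxy) hne
  have hodd := h_odd hr hh hf (sq_even hr hh hf hfan hadd')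
  have hfodd : ∀ y ∈ PDisc r, f (-y) = - f y := by
    intro y hy
    rw [hf _ (neg_mem_PDisc hy), hf y hy, hodd y hy.1, div_neg]
    ring
  have hneg : ∀ z ∈ Metric.ball (0 : ℂ) r, -z ∈ Metric.ball (0 : ℂ) r := by
    intro z hz; simpa using hz
  obtain ⟨H, hH⟩ : ∃ H : ℂ → ℂ, ∀ z ∈ Metric.ball (0 : ℂ) r, HasDerivAt H (h z) z :=
    DifferentiableOn.isExactOn_ball
      (fun z hz => (hh z hz).differentiableAt.differentiableWithinAt)
  have hHeven : ∀ z ∈ Metric.ball (0 : ℂ) r, H (-z) = H z := by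
    have hd : ∀ z ∈ Metric.ball (0 : ℂ) r, HasDerivAt (fun z => H (-z) - H z) 0 z := by
      intro z hz
      have h1 : HasDerivAt (fun z => H (-z)) (h (-z) * (-1)) z :=
        (hH _ (hneg z hz)).comp z (hasDerivAt_neg z)
      refine (h1.sub (hH z hz)).congr_deriv ?_
      rw [hodd z hz]; ring
    intro z hz
    have h1 := Metric.isOpen_ball.is_const_of_deriv_eq_zero Metric.isPreconnected_ball
      (fun z hz => (hd z hz).differentiableAt.differentiableWithinAt)
      (fun z hz => (hd z hz).deriv) hz h0
    simp only [neg_zero, sub_self] at h1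
    exact sub_eq_zero.1 h1
  obtain ⟨C, hC⟩ := g_form hr hf hfan hH hgmer hlog
  refine ⟨?_, ?_, hgne⟩
  · intro x y hx hy hxy hxy' _ _ g1 g2
    rw [hC _ hxy g1, hC _ hxy' g2]
    linear_combination C * core hr hh hf hfan hadd' hfodd hH hHeven x y hx hy hxy hxy'
  · by_contra hcon
    push Not at hcon
    have hz : ∀ z ∈ PDisc r, f z = 0 := fun z hz => hcon z hz (hfan z hz)
    -- then `1 + z h z = 0` on the punctured disc, contradiction at `0`
    have hc : ContinuousAt (fun z => 1 + z * h z) 0 := by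
      have := (hh 0 h0).continuousAt
      fun_prop
    have hne : ∀ᶠ z in nhds (0 : ℂ), 1 + z * h z ≠ 0 := hc.eventually_ne (by simp)
    have hall : ∀ᶠ z in nhdsWithin (0 : ℂ) {0}ᶜ, False := by
      filter_upwards [nhdsWithin_le_nhds hne,
        nhdsWithin_le_nhds (Metric.isOpen_ball.mem_nhds h0), self_mem_nhdsWithin] with z a b c
      have hz0 : z ≠ 0 := c
      have h1 := hf z ⟨b, c⟩
      rw [hz z ⟨b, c⟩] at h1
      apply a
      field_simp at h1
      linear_combination -h1
    exact hall.exists.elim fun _ h => h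
end

section
/- Let f, g, h be meromorphic on a punctured open disc D ∖ {0} around 0 in ℂ, satisfying the A₂ functional equation, each having a simple pole at 0 with residue 1 (i.e. f(u) − 1/u, g(u) − 1/u, h(u) − 1/u extend holomorphically to 0). Then there exist constants a, b, c, c₂, c₃ ∈ ℂ and an even meromorphic function P on a punctured disc around 0 such that P(u) − 1/u² extends holomorphically to 0 with value 0 there, f(u)f(−u) = a − P(u), g(u)g(−u) = b − P(u), h(u)h(−u) = c − P(u), and P′(u)² = 4P(u)³ + c₂ P(u) + c₃, wherever the functions involved are analytic. -/
/-- The triple `(f, g, h)` satisfies the `A₂` functional equation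
`f(u)g(u+v) + g(v)h(−u) + h(−u−v)f(−v) = 0` on the punctured disc of
radius `r`, whenever `±u, ±v, ±(u+v)` lie in the punctured disc and the
relevant functions are analytic at the points where they are evaluated. -/
def A2FE (r : ℝ) (f g h : ℂ → ℂ) : Prop :=
  ∀ u v : ℂ, u ∈ PDisc r → -u ∈ PDisc r → v ∈ PDisc r → -v ∈ PDisc r →
    u + v ∈ PDisc r → -(u + v) ∈ PDisc r →
    AnalyticAt ℂ f u → AnalyticAt ℂ f (-v) → AnalyticAt ℂ g (u + v) →
    AnalyticAt ℂ g v → AnalyticAt ℂ h (-u) → AnalyticAt ℂ h (-(u + v)) →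
    f u * g (u + v) + g v * h (-u) + h (-(u + v)) * f (-v) = 0

/-- `f` has a simple pole at `0` with residue `c`: on a punctured neighbourhood
of `0`, `f(z) = c/z + (analytic)`. -/
def SimplePoleAtZeroRes (f : ℂ → ℂ) (c : ℂ) : Prop :=
  ∃ F : ℂ → ℂ, AnalyticAt ℂ F 0 ∧
    ∀ᶠ z in nhdsWithin (0 : ℂ) {(0 : ℂ)}ᶜ, f z = c / z + F z

lemma pdisc_neg {ρ : ℝ} {u : ℂ} (hu : u ∈ PDisc ρ) : -u ∈ PDisc ρ := by
  simpa [PDisc] using hu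

lemma pdisc_open (ρ : ℝ) : IsOpen (PDisc ρ) :=
  Metric.isOpen_ball.sdiff isClosed_singleton

lemma pdisc_preconnected {ρ : ℝ} (hρ : 0 < ρ) : IsPreconnected (PDisc ρ) := by
  have h1 : PDisc ρ = Complex.exp '' {z : ℂ | z.re < Real.log ρ} := by
    ext u
    simp only [PDisc, Set.mem_sdiff, Metric.mem_ball, dist_zero_right, Set.mem_singleton_iff,
      Set.mem_image, Set.mem_ofPred_eq]
    constructor
    · rintro ⟨h, h0⟩
      refine ⟨Complex.log u, ?_, Complex.exp_log h0⟩
      rw [Complex.log_re]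
      exact Real.log_lt_log (norm_pos_iff.mpr h0) h
    · rintro ⟨z, hz, rfl⟩
      refine ⟨?_, Complex.exp_ne_zero z⟩
      rw [Complex.norm_exp]
      calc Real.exp z.re < Real.exp (Real.log ρ) := Real.exp_lt_exp.mpr hz
        _ = ρ := Real.exp_log hρ
  rw [h1]
  exact (convex_halfSpace_re_lt _).isPreconnected.image _ Complex.continuous_exp.continuousOn

lemma pdisc_const {ρ : ℝ} (hρ : 0 < ρ) {φ : ℂ → ℂ}
    (hφ : ∀ u ∈ PDisc ρ, HasDerivAt φ 0 u) : ∃ K, ∀ u ∈ PDisc ρ, φ u = K := by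
  refine (pdisc_open ρ).exists_is_const_of_deriv_eq_zero (pdisc_preconnected hρ)
    (fun u hu => (hφ u hu).differentiableAt.differentiableWithinAt) (fun u hu => (hφ u hu).deriv)

lemma pdisc_mem_nhdsNE {ρ : ℝ} (hρ : 0 < ρ) : PDisc ρ ∈ nhdsWithin (0 : ℂ) {(0 : ℂ)}ᶜ := by
  rw [PDisc, Set.sdiff_eq, Set.inter_comm]
  exact inter_mem_nhdsWithin _ (Metric.ball_mem_nhds _ hρ)

lemma A2FE_cyc {r : ℝ} {f g h : ℂ → ℂ} (H : A2FE r f g h) : A2FE r h f g := by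
  intro u v hu hu' hv hv' huv huv' a1 a2 a3 a4 a5 a6
  have e : v + -(u + v) = -u := by ring
  have := H v (-(u + v)) hv hv' huv' (by simpa using huv) (by rwa [e]) (by rw [e]; simpa using hu)
    a4 (by simpa using a3) (by rwa [e]) a6 a2 (by rw [e]; simpa using a1)
  rw [e] at this
  simp only [neg_neg] at this
  linear_combination this

/-- Local data: `f = 1/z + F` on the punctured disc of radius `ρ`, `F` analytic on the disc. -/
structure Loc (ρ : ℝ) (f F : ℂ → ℂ) : Prop where
  an : AnalyticOnNhd ℂ F (Metric.ball 0 ρ)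
  eq : ∀ z ∈ PDisc ρ, f z = 1 / z + F z

lemma exists_loc {f : ℂ → ℂ} (hf : SimplePoleAtZeroRes f 1) :
    ∃ F : ℂ → ℂ, ∃ ρ > 0, Loc ρ f F := by
  obtain ⟨F, hF, he⟩ := hf
  have h1 := hF.eventually_analyticAt
  rw [eventually_nhdsWithin_iff] at he
  obtain ⟨ρ, hρ, hb⟩ := Metric.eventually_nhds_iff_ball.mp (h1.and he)
  exact ⟨F, ρ, hρ, fun z hz => (hb z hz).1, fun z hz => (hb z hz.1).2 hz.2⟩

lemma Loc.mono {ρ ρ' : ℝ} {f F : ℂ → ℂ} (h : Loc ρ f F) (hl : ρ' ≤ ρ) : Loc ρ' f F :=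
  ⟨h.an.mono (Metric.ball_subset_ball hl),
    fun z hz => h.eq z ⟨Metric.ball_subset_ball hl hz.1, hz.2⟩⟩

lemma Loc.analyticAt {ρ : ℝ} {f F : ℂ → ℂ} (h : Loc ρ f F) {u : ℂ} (hu : u ∈ PDisc ρ) :
    AnalyticAt ℂ f u := by
  have h1 : AnalyticAt ℂ (fun z => 1 / z + F z) u :=
    (analyticAt_const.div analyticAt_id hu.2).add (h.an u hu.1)
  refine h1.congr ?_
  filter_upwards [(pdisc_open ρ).mem_nhds hu] with z hz
  exact (h.eq z hz).symm

lemma Loc.d1 {ρ : ℝ} {f F : ℂ → ℂ} (h : Loc ρ f F) {u : ℂ} (hu : u ∈ PDisc ρ) :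
    HasDerivAt f (deriv f u) u := (h.analyticAt hu).differentiableAt.hasDerivAt

lemma Loc.d2 {ρ : ℝ} {f F : ℂ → ℂ} (h : Loc ρ f F) {u : ℂ} (hu : u ∈ PDisc ρ) :
    HasDerivAt (deriv f) (deriv (deriv f) u) u :=
  (h.analyticAt hu).deriv.differentiableAt.hasDerivAt

lemma Loc.d1n {ρ : ℝ} {f F : ℂ → ℂ} (h : Loc ρ f F) {u : ℂ} (hu : u ∈ PDisc ρ) :
    HasDerivAt (fun z => f (-z)) (-deriv f (-u)) u := by
  exact ((h.d1 (pdisc_neg hu)).comp u (hasDerivAt_neg u)).congr_deriv (by ring)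

lemma Loc.d2n {ρ : ℝ} {f F : ℂ → ℂ} (h : Loc ρ f F) {u : ℂ} (hu : u ∈ PDisc ρ) :
    HasDerivAt (fun z => deriv f (-z)) (-deriv (deriv f) (-u)) u := by
  exact ((h.d2 (pdisc_neg hu)).comp u (hasDerivAt_neg u)).congr_deriv (by ring)

lemma Loc.expand {ρ : ℝ} (hρ : 0 < ρ) {f F : ℂ → ℂ} (h : Loc ρ f F) :
    ∃ Q : ℂ → ℂ, AnalyticAt ℂ Q 0 ∧ Q 0 = 0 ∧ ∀ z ∈ PDisc ρ,
      f z * f (-z) = (F 0 ^ 2 - 2 * deriv F 0) - 1 / z ^ 2 - Q z := by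
  have hb : Metric.ball (0 : ℂ) ρ ∈ nhds (0 : ℂ) := Metric.ball_mem_nhds _ hρ
  have hS : AnalyticAt ℂ (dslope F 0) 0 :=
    ((Complex.differentiableOn_dslope hb).mpr h.an.differentiableOn).analyticAt hb
  have hF : AnalyticAt ℂ F 0 := h.an 0 (Metric.mem_ball_self hρ)
  have hneg : AnalyticAt ℂ (fun z : ℂ => -z) 0 := analyticAt_id.neg
  refine ⟨fun z => (F 0 ^ 2 - 2 * deriv F 0) + dslope F 0 z + dslope F 0 (-z) - F z * F (-z),
    ?_, ?_, ?_⟩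
  · have a1 : AnalyticAt ℂ (fun z => dslope F 0 (-z)) 0 :=
      AnalyticAt.fun_comp (f := fun z : ℂ => -z) (by simpa using hS) hneg
    have a2 : AnalyticAt ℂ (fun z => F (-z)) 0 :=
      AnalyticAt.fun_comp (f := fun z : ℂ => -z) (by simpa using hF) hneg
    exact ((analyticAt_const.add hS).add a1).sub (hF.mul a2)
  · simp [dslope_same]; ring
  · intro z hz
    have hz0 : z ≠ 0 := hz.2
    have e1 : z * dslope F 0 z = F z - F 0 := by simpa using sub_smul_dslope F 0 z
    have e2 : -z * dslope F 0 (-z) = F (-z) - F 0 := by simpa using sub_smul_dslope F 0 (-z)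
    have e3 : F z = F 0 + z * dslope F 0 z := by linear_combination -e1
    have e4 : F (-z) = F 0 - z * dslope F 0 (-z) := by linear_combination -e2
    rw [h.eq z hz, h.eq (-z) (pdisc_neg hz)]
    simp only [e3, e4]
    field_simp
    ring

/-- First and second order consequences of the functional equation. -/
lemma key {r ρ : ℝ} (hρ : 0 < ρ) (hl : ρ ≤ r) {f g h F G H : ℂ → ℂ} (hfe : A2FE r f g h)
    (lf : Loc ρ f F) (lg : Loc ρ g G) (lh : Loc ρ h H) {u : ℂ} (hu : u ∈ PDisc ρ) :
    f u * g u + (F 0 + G 0) * h (-u) + deriv h (-u) = 0 ∧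
    2 * (f u * deriv g u) + 2 * (deriv G 0 - deriv F 0) * h (-u) - deriv (deriv h) (-u)
      - 2 * F 0 * deriv h (-u) = 0 := by
  have hsub : ∀ z, z ∈ PDisc ρ → z ∈ PDisc r :=
    fun z hz => ⟨Metric.ball_subset_ball hl hz.1, hz.2⟩
  have hF0 : (0 : ℂ) ∈ Metric.ball (0 : ℂ) ρ := Metric.mem_ball_self hρ
  have hnb : ∀ᶠ v in nhds (0 : ℂ), u + v ∈ PDisc ρ ∧ v ∈ Metric.ball (0 : ℂ) ρ := by
    refine Filter.Eventually.and ?_ (Metric.ball_mem_nhds _ hρ)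
    have : ContinuousAt (fun v : ℂ => u + v) 0 := by fun_prop
    exact this.eventually_mem ((pdisc_open ρ).mem_nhds (by simpa using hu))
  set φ : ℂ → ℂ := fun v => v * f u * g (u + v) + (1 + v * G v) * h (-u)
    + h (-(u + v)) * (-1 + v * F (-v)) with hφ
  have hz : ∀ᶠ v in nhds (0 : ℂ), φ v = 0 := by
    filter_upwards [hnb] with v hv
    by_cases hv0 : v = 0
    · subst hv0; simp [hφ]
    have hvS : v ∈ PDisc ρ := ⟨hv.2, hv0⟩
    have hnv := pdisc_neg hvS
    have hnu := pdisc_neg hu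
    have hnuv := pdisc_neg hv.1
    have := hfe u v (hsub _ hu) (hsub _ hnu) (hsub _ hvS) (hsub _ hnv) (hsub _ hv.1)
      (hsub _ hnuv) (lf.analyticAt hu) (lf.analyticAt hnv) (lg.analyticAt hv.1)
      (lg.analyticAt hvS) (lh.analyticAt hnu) (lh.analyticAt hnuv)
    rw [lg.eq v hvS, lf.eq (-v) hnv] at this
    have e : φ v = v * (f u * g (u + v) + (1 / v + G v) * h (-u)
        + h (-(u + v)) * (1 / (-v) + F (-v))) := by
      simp only [hφ]; field_simp
    rw [e, this, mul_zero]
  set ψ : ℂ → ℂ := fun v => f u * g (u + v) + v * f u * deriv g (u + v)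
    + (G v + v * deriv G v) * h (-u) - deriv h (-(u + v)) * (-1 + v * F (-v))
    + h (-(u + v)) * (F (-v) - v * deriv F (-v)) with hψ
  have hshift : ∀ v : ℂ, HasDerivAt (fun v : ℂ => u + v) 1 v :=
    fun v => (hasDerivAt_id v).const_add u
  have hshiftn : ∀ v : ℂ, HasDerivAt (fun v : ℂ => -(u + v)) (-1) v := fun v => (hshift v).neg
  have hd : ∀ᶠ v in nhds (0 : ℂ), HasDerivAt φ (ψ v) v := by
    filter_upwards [hnb] with v hv
    have dg := (lg.d1 hv.1).comp v (hshift v)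
    have dh := (lh.d1 (pdisc_neg hv.1)).comp v (hshiftn v)
    have dG := (lg.an v hv.2).differentiableAt.hasDerivAt
    have hv2 : -v ∈ Metric.ball (0 : ℂ) ρ := by simpa using hv.2
    have dF := (lf.an (-v) hv2).differentiableAt.hasDerivAt.comp v (hasDerivAt_neg v)
    have d := ((((hasDerivAt_id v).mul_const (f u)).mul dg).add
      ((((hasDerivAt_id v).mul dG).const_add 1).mul_const (h (-u)))).add
      (dh.mul (((hasDerivAt_id v).mul dF).const_add (-1)))
    refine d.congr_deriv ?_
    simp only [hψ, Function.comp, id, Pi.mul_apply]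
    ring
  have hψ0 : ∀ᶠ v in nhds (0 : ℂ), ψ v = 0 := by
    filter_upwards [hd, hz.eventually_nhds] with v h1 h2
    have h3 : φ =ᶠ[nhds v] fun _ => (0 : ℂ) := h2
    exact h1.unique ((hasDerivAt_const v (0 : ℂ)).congr_of_eventuallyEq h3)
  have hA := hψ0.self_of_nhds
  have d2 : HasDerivAt ψ (2 * (f u * deriv g u) + 2 * (deriv G 0 - deriv F 0) * h (-u)
      - deriv (deriv h) (-u) - 2 * F 0 * deriv h (-u)) 0 := by
    have hu0 : u + 0 ∈ PDisc ρ := by simpa using hu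
    have dg := (lg.d1 hu0).comp 0 (hshift 0)
    have dg' := (lg.d2 hu0).comp 0 (hshift 0)
    have dh := (lh.d1 (pdisc_neg hu0)).comp 0 (hshiftn 0)
    have dh' := (lh.d2 (pdisc_neg hu0)).comp 0 (hshiftn 0)
    have dG := (lg.an 0 hF0).differentiableAt.hasDerivAt
    have dG' := (lg.an 0 hF0).deriv.differentiableAt.hasDerivAt
    have hn0 : -(0 : ℂ) ∈ Metric.ball (0 : ℂ) ρ := by simpa using hF0
    have dF := (lf.an _ hn0).differentiableAt.hasDerivAt.comp 0 (hasDerivAt_neg 0)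
    have dF' := (lf.an _ hn0).deriv.differentiableAt.hasDerivAt.comp 0 (hasDerivAt_neg 0)
    have did := hasDerivAt_id (0 : ℂ)
    have d := (((((dg.const_mul (f u)).add ((did.mul_const (f u)).mul dg')).add
      ((dG.add (did.mul dG')).mul_const (h (-u)))).sub
      (dh'.mul ((did.mul dF).const_add (-1)))).add
      (dh.mul (dF.sub (did.mul dF'))))
    refine d.congr_deriv ?_
    simp only [Function.comp, id, neg_zero, add_zero, Pi.mul_apply, Pi.sub_apply]
    ring
  refine ⟨?_, ?_⟩
  · simp only [hψ, neg_zero, add_zero, zero_mul, mul_neg, mul_one, sub_zero] at hA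
    linear_combination hA
  · have h3 : ψ =ᶠ[nhds 0] fun _ => (0 : ℂ) := hψ0
    exact d2.unique ((hasDerivAt_const (0 : ℂ) (0 : ℂ)).congr_of_eventuallyEq h3)

lemma Loc.deriv_eq {ρ : ℝ} {f F : ℂ → ℂ} (h : Loc ρ f F) {u : ℂ} (hu : u ∈ PDisc ρ) :
    deriv f u = -1 / u ^ 2 + deriv F u := by
  have hu0 : u ≠ 0 := hu.2
  have h1 : HasDerivAt (fun z => z⁻¹ + F z) (-(u ^ 2)⁻¹ + deriv F u) u :=
    (hasDerivAt_inv hu0).add (h.an u hu.1).differentiableAt.hasDerivAt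
  have h2 : f =ᶠ[nhds u] fun z => z⁻¹ + F z := by
    filter_upwards [(pdisc_open ρ).mem_nhds hu] with z hz
    rw [h.eq z hz, one_div]
  rw [(h1.congr_of_eventuallyEq h2).deriv]
  ring

/-- The relation between the Taylor coefficients. -/
lemma coeff_rel {r ρ : ℝ} (hρ : 0 < ρ) (hl : ρ ≤ r) {f g h F G H : ℂ → ℂ} (hfe : A2FE r f g h)
    (lf : Loc ρ f F) (lg : Loc ρ g G) (lh : Loc ρ h H) :
    deriv F 0 + deriv G 0 + deriv H 0 + F 0 * G 0 + (F 0 + G 0) * H 0 = 0 := by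
  have hb : Metric.ball (0 : ℂ) ρ ∈ nhds (0 : ℂ) := Metric.ball_mem_nhds _ hρ
  have hF0 : (0 : ℂ) ∈ Metric.ball (0 : ℂ) ρ := Metric.mem_ball_self hρ
  have cS : ∀ {f F : ℂ → ℂ}, Loc ρ f F → ContinuousAt (dslope F 0) 0 := fun l =>
    continuousAt_dslope_same.mpr (l.an 0 hF0).differentiableAt
  have cF := (lf.an 0 hF0).continuousAt
  have cG := (lg.an 0 hF0).continuousAt
  have cH : ContinuousAt (fun z => H (-z)) 0 :=
    ContinuousAt.comp' (f := fun z : ℂ => -z) (by simpa using (lh.an 0 hF0).continuousAt)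
      continuous_neg.continuousAt
  have cH' : ContinuousAt (fun z => deriv H (-z)) 0 :=
    ContinuousAt.comp' (f := fun z : ℂ => -z)
      (by simpa using (lh.an 0 hF0).deriv.continuousAt) continuous_neg.continuousAt
  have c : ContinuousAt (fun z => dslope F 0 z + dslope G 0 z + deriv H (-z) + F z * G z
      + (F 0 + G 0) * H (-z)) 0 :=
    ((((cS lf).add (cS lg)).add cH').add (cF.mul cG)).add (continuousAt_const.mul cH)
  have t1 := c.tendsto.mono_left (nhdsWithin_le_nhds (s := {(0 : ℂ)}ᶜ))
  have t2 : Filter.Tendsto (fun z => dslope F 0 z + dslope G 0 z + deriv H (-z) + F z * G z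
      + (F 0 + G 0) * H (-z)) (nhdsWithin (0 : ℂ) {(0 : ℂ)}ᶜ) (nhds 0) := by
    refine tendsto_const_nhds.congr' ?_
    filter_upwards [pdisc_mem_nhdsNE hρ] with z hz
    have hz0 : z ≠ 0 := hz.2
    have k := (key hρ hl hfe lf lg lh hz).1
    rw [lf.eq z hz, lg.eq z hz, lh.eq _ (pdisc_neg hz), lh.deriv_eq (pdisc_neg hz)] at k
    have e1 : z * dslope F 0 z = F z - F 0 := by simpa using sub_smul_dslope F 0 z
    have e2 : z * dslope G 0 z = G z - G 0 := by simpa using sub_smul_dslope G 0 z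
    have e1' : dslope F 0 z = (F z - F 0) / z := by rw [← e1]; field_simp
    have e2' : dslope G 0 z = (G z - G 0) / z := by rw [← e2]; field_simp
    rw [e1', e2']
    refine k.symm.trans ?_
    field_simp
    ring
  have := tendsto_nhds_unique t1 t2
  simpa [dslope_same] using this

/-- Two of the products differ by the expected constant. -/
lemma prod_diff {ρ : ℝ} (hρ : 0 < ρ) {f g F G : ℂ → ℂ}
    (lf : Loc ρ f F) (lg : Loc ρ g G)
    (hD : ∀ u ∈ PDisc ρ, deriv f u * f (-u) - f u * deriv f (-u)
      = deriv g u * g (-u) - g u * deriv g (-u)) :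
    ∀ u ∈ PDisc ρ, f u * f (-u) - g u * g (-u)
      = (F 0 ^ 2 - 2 * deriv F 0) - (G 0 ^ 2 - 2 * deriv G 0) := by
  obtain ⟨K, hK⟩ : ∃ K, ∀ u ∈ PDisc ρ, f u * f (-u) - g u * g (-u) = K := by
    refine pdisc_const hρ (φ := fun u => f u * f (-u) - g u * g (-u)) fun u hu => ?_
    have d := ((lf.d1 hu).mul (lf.d1n hu)).sub ((lg.d1 hu).mul (lg.d1n hu))
    refine d.congr_deriv ?_
    linear_combination hD u hu
  obtain ⟨Q, aQ, Q0, hQ⟩ := lf.expand hρ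
  obtain ⟨R, aR, R0, hR⟩ := lg.expand hρ
  have c : ContinuousAt (fun z => (F 0 ^ 2 - 2 * deriv F 0) - (G 0 ^ 2 - 2 * deriv G 0)
      - Q z + R z) 0 := (continuousAt_const.sub aQ.continuousAt).add aR.continuousAt
  have t1 := c.tendsto.mono_left (nhdsWithin_le_nhds (s := {(0 : ℂ)}ᶜ))
  have t2 : Filter.Tendsto (fun z => (F 0 ^ 2 - 2 * deriv F 0) - (G 0 ^ 2 - 2 * deriv G 0)
      - Q z + R z) (nhdsWithin (0 : ℂ) {(0 : ℂ)}ᶜ) (nhds K) := by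
    refine tendsto_const_nhds.congr' ?_
    filter_upwards [pdisc_mem_nhdsNE hρ] with z hz
    rw [← hK z hz, hQ z hz, hR z hz]; ring
  have := tendsto_nhds_unique t1 t2
  intro u hu
  rw [hK u hu, ← this, Q0, R0]; ring

theorem a2_solution_weierstrass_structure
    (r : ℝ) (hr : 0 < r) (f g h : ℂ → ℂ)
    (hfmer : MeromorphicOn f (PDisc r)) (hgmer : MeromorphicOn g (PDisc r))
    (hhmer : MeromorphicOn h (PDisc r))
    (hfe : A2FE r f g h)
    (hf1 : SimplePoleAtZeroRes f 1)
    (hg1 : SimplePoleAtZeroRes g 1)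
    (hh1 : SimplePoleAtZeroRes h 1) :
    ∃ (a b c c₂ c₃ : ℂ) (P : ℂ → ℂ) (ρ : ℝ), 0 < ρ ∧ ρ ≤ r ∧
      MeromorphicOn P (PDisc ρ) ∧
      -- `P` is even:
      (∀ u ∈ PDisc ρ, AnalyticAt ℂ P u → AnalyticAt ℂ P (-u) → P (-u) = P u) ∧
      -- `P(u) − 1/u²` extends holomorphically to `0` with value `0` there:
      (∃ Q : ℂ → ℂ, AnalyticAt ℂ Q 0 ∧ Q 0 = 0 ∧
        ∀ᶠ z in nhdsWithin (0 : ℂ) {(0 : ℂ)}ᶜ, P z = 1 / z ^ 2 + Q z) ∧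
      (∀ u ∈ PDisc ρ, AnalyticAt ℂ f u → AnalyticAt ℂ f (-u) → AnalyticAt ℂ P u →
        f u * f (-u) = a - P u) ∧
      (∀ u ∈ PDisc ρ, AnalyticAt ℂ g u → AnalyticAt ℂ g (-u) → AnalyticAt ℂ P u →
        g u * g (-u) = b - P u) ∧
      (∀ u ∈ PDisc ρ, AnalyticAt ℂ h u → AnalyticAt ℂ h (-u) → AnalyticAt ℂ P u →
        h u * h (-u) = c - P u) ∧
      (∀ u ∈ PDisc ρ, AnalyticAt ℂ P u →
        (deriv P u) ^ 2 = 4 * P u ^ 3 + c₂ * P u + c₃) := by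
  obtain ⟨F, ρ₁, hρ₁, lf⟩ := exists_loc hf1
  obtain ⟨G, ρ₂, hρ₂, lg⟩ := exists_loc hg1
  obtain ⟨H, ρ₃, hρ₃, lh⟩ := exists_loc hh1
  obtain ⟨ρ, hρ, hl, hl1, hl2, hl3⟩ : ∃ ρ : ℝ, 0 < ρ ∧ ρ ≤ r ∧ ρ ≤ ρ₁ ∧ ρ ≤ ρ₂ ∧ ρ ≤ ρ₃ :=
    ⟨min (min r ρ₁) (min ρ₂ ρ₃), by positivity, by simp, by simp, by simp, by simp⟩
  replace lf := lf.mono hl1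
  replace lg := lg.mono hl2
  replace lh := lh.mono hl3
  have kh := fun u hu => key (u := u) hρ hl hfe lf lg lh hu
  have kg := fun u hu => key (u := u) hρ hl (A2FE_cyc hfe) lh lf lg hu
  have kf := fun u hu => key (u := u) hρ hl (A2FE_cyc (A2FE_cyc hfe)) lg lh lf hu
  have rel := coeff_rel hρ hl hfe lf lg lh
  -- the products have the same derivative
  have Dfg : ∀ u ∈ PDisc ρ, deriv f u * f (-u) - f u * deriv f (-u)
      = deriv g u * g (-u) - g u * deriv g (-u) := by
    intro u hu
    have a1 := (kf u hu).1
    have a2 := (kf (-u) (pdisc_neg hu)).1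
    have b1 := (kg u hu).1
    have b2 := (kg (-u) (pdisc_neg hu)).1
    rw [neg_neg] at a2 b2
    linear_combination f (-u) * a2 - f u * a1 - g (-u) * b2 + g u * b1
  have Dfh : ∀ u ∈ PDisc ρ, deriv f u * f (-u) - f u * deriv f (-u)
      = deriv h u * h (-u) - h u * deriv h (-u) := by
    intro u hu
    have a1 := (kf u hu).1
    have a2 := (kf (-u) (pdisc_neg hu)).1
    have b1 := (kh u hu).1
    have b2 := (kh (-u) (pdisc_neg hu)).1
    rw [neg_neg] at a2 b2
    linear_combination f (-u) * a2 - f u * a1 - h (-u) * b2 + h u * b1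
  have Cfg := prod_diff hρ lf lg Dfg
  have Cfh := prod_diff hρ lf lh Dfh
  -- derivative of the first order relation
  have kd : ∀ u ∈ PDisc ρ, deriv f u * g u + f u * deriv g u - (F 0 + G 0) * deriv h (-u)
      - deriv (deriv h) (-u) = 0 := by
    intro u hu
    have d := (((lf.d1 hu).mul (lg.d1 hu)).add ((lh.d1n hu).const_mul (F 0 + G 0))).add
      (lh.d2n hu)
    have h0 : (fun z => f z * g z + (F 0 + G 0) * h (-z) + deriv h (-z))
        =ᶠ[nhds u] fun _ => (0 : ℂ) := by
      filter_upwards [(pdisc_open ρ).mem_nhds hu] with z hz using (kh z hz).1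
    have := d.unique ((hasDerivAt_const u (0 : ℂ)).congr_of_eventuallyEq h0)
    linear_combination this
  -- the second order relation
  have W : ∀ u ∈ PDisc ρ, deriv (deriv h) u * h (-u) - h u * deriv (deriv h) (-u)
      = 2 * H 0 * (deriv h u * h (-u) - h u * deriv h (-u)) := by
    have half : ∀ u ∈ PDisc ρ, deriv f u * deriv f (-u) = -(G 0 + H 0) * (deriv f u * f (-u))
        - h u * deriv (deriv h) (-u) / 2 - G 0 * (h u * deriv h (-u))
        - (deriv G 0 - deriv F 0) * (h u * h (-u)) := by
      intro u hu
      have a1 := (kf u hu).1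
      have a2 := kd u hu
      have a3 := (kh u hu).2
      linear_combination deriv f u * a1 - h u * a2 + h u * a3 / 2
    intro u hu
    have p := half u hu
    have q := half (-u) (pdisc_neg hu)
    rw [neg_neg] at q
    linear_combination -2 * p + 2 * q + 2 * (G 0 + H 0) * Dfh u hu
  obtain ⟨K, hK⟩ : ∃ K, ∀ u ∈ PDisc ρ, h u * deriv h (-u) + deriv h u * h (-u)
      - 2 * H 0 * (h u * h (-u)) = K := by
    refine pdisc_const hρ (φ := fun u => h u * deriv h (-u) + deriv h u * h (-u)
      - 2 * H 0 * (h u * h (-u))) fun u hu => ?_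
    have d := (((lh.d1 hu).mul (lh.d2n hu)).add ((lh.d2 hu).mul (lh.d1n hu))).sub
      (((lh.d1 hu).mul (lh.d1n hu)).const_mul (2 * H 0))
    refine d.congr_deriv ?_
    linear_combination W u hu
  obtain ⟨Q, aQ, Q0, hQ⟩ := lf.expand hρ
  obtain ⟨a, ha⟩ : ∃ a, a = F 0 ^ 2 - 2 * deriv F 0 := ⟨_, rfl⟩
  obtain ⟨b, hb⟩ : ∃ b, b = G 0 ^ 2 - 2 * deriv G 0 := ⟨_, rfl⟩
  obtain ⟨c, hc⟩ : ∃ c, c = H 0 ^ 2 - 2 * deriv H 0 := ⟨_, rfl⟩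
  obtain ⟨s, hs⟩ : ∃ s, s = F 0 + G 0 + H 0 := ⟨_, rfl⟩
  have habc : a + b + c = s ^ 2 := by
    rw [ha, hb, hc, hs]; linear_combination -2 * rel
  rw [← ha] at hQ
  rw [← ha, ← hb] at Cfg
  rw [← ha, ← hc] at Cfh
  refine ⟨a, b, c, -4 * s * (2 * s * c + K) + 4 * (a * b + b * c + c * a),
    (2 * s * c + K) ^ 2 - 4 * a * b * c, fun u => a - f u * f (-u), ρ, hρ, hl,
    ?_, ?_, ⟨Q, aQ, Q0, ?_⟩, ?_, ?_, ?_, ?_⟩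
  · intro u hu
    have h2 : AnalyticAt ℂ (fun z => f (-z)) u :=
      AnalyticAt.fun_comp (f := fun z : ℂ => -z) (lf.analyticAt (pdisc_neg hu)) analyticAt_id.neg
    exact (analyticAt_const.sub ((lf.analyticAt hu).mul h2)).meromorphicAt
  · intro u _ _ _
    simp only [neg_neg]; ring
  · filter_upwards [pdisc_mem_nhdsNE hρ] with z hz
    rw [hQ z hz]; ring
  · intro u _ _ _ _; ring
  · intro u hu _ _ _
    linear_combination -Cfg u hu
  · intro u hu _ _ _
    linear_combination -Cfh u hu
  · intro u hu _
    have d : HasDerivAt (fun u => a - f u * f (-u))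
        (-(deriv f u * f (-u) + f u * -deriv f (-u))) u :=
      ((lf.d1 hu).mul (lf.d1n hu)).const_sub a
    rw [d.deriv]
    obtain ⟨p, hp⟩ : ∃ p, p = a - f u * f (-u) := ⟨_, rfl⟩
    have pf : f u * f (-u) = a - p := by rw [hp]; ring
    have pg : g u * g (-u) = b - p := by rw [hp]; linear_combination -Cfg u hu
    have ph : h u * h (-u) = c - p := by rw [hp]; linear_combination -Cfh u hu
    obtain ⟨T, hT⟩ : ∃ T, T = f u * g u * h u := ⟨_, rfl⟩
    obtain ⟨T', hT'⟩ : ∃ T', T' = f (-u) * g (-u) * h (-u) := ⟨_, rfl⟩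
    have b1 := (kh u hu).1
    have b2 := (kh (-u) (pdisc_neg hu)).1
    rw [neg_neg] at b2
    have eD : -(deriv f u * f (-u) + f u * -deriv f (-u)) = T' - T := by
      rw [hT, hT']
      linear_combination -Dfh u hu + h u * b1 - h (-u) * b2
    have eS : T + T' = -2 * s * (c - p) - K := by
      rw [hT, hT', hs, ← ph]
      linear_combination h u * b1 + h (-u) * b2 - hK u hu
    have eP : T * T' = (a - p) * (b - p) * (c - p) := by
      rw [hT, hT', ← pf, ← pg, ← ph]; ring
    rw [eD]
    simp only [← hp]
    have : (T' - T) ^ 2 = (T + T') ^ 2 - 4 * (T * T') := by ring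
    rw [this, eS, eP]
    linear_combination -4 * p ^ 2 * habc
end

section
/- Fix an integer n ≥ 2, τ ∈ ℂ with Im τ > 0, L = ℤ + τℤ, k ∈ ℂ, and λ ∈ ℂⁿ such that λ_i − λ_j ∉ L for all i ≠ j. Let U = {x ∈ ℂⁿ : x_i − x_j ∉ L for all i ≠ j}, and for a function F holomorphic on U satisfying F(x₁ + a, …, xₙ + a) = F(x₁, …, xₙ) for all a ∈ ℂ, define the elliptic Dunkl operators (∇_i F)(x) = (∂F/∂x_i)(x) + k Σ_{j ≠ i} σ_{λ_i − λ_j}(x_i − x_j) F(s_{ij}x), where s_{ij}x is obtained from x by exchanging the i-th and j-th coordinates. Then each ∇_i F is again holomorphic on U and translation-invariant, and the operators commute pairwise: ∇_i(∇_j F) = ∇_j(∇_i F) on U for all i, j and every such F. -/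
/-!
STATEMENT 19: The elliptic Dunkl operators
`(∇_i F)(x) = ∂F/∂x_i + k Σ_{j≠i} σ_{λ_i−λ_j}(x_i−x_j) F(s_{ij}x)`
preserve the space of translation-invariant holomorphic functions on
`U = {x : x_i − x_j ∉ L for i ≠ j}` and commute pairwise.
-/

open Complex

/-- The lattice `L = ℤ + τℤ ⊆ ℂ`. -/
def lat (τ : ℂ) : Set ℂ := {w : ℂ | ∃ m n : ℤ, w = (m : ℂ) + (n : ℂ) * τ}

/-- Jacobi's theta function
`θ₁(z) = −Σ_{n∈ℤ} exp(2πi(z+1/2)(n+1/2) + πiτ(n+1/2)²)`. -/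
noncomputable def theta1 (τ z : ℂ) : ℂ :=
  -∑' n : ℤ, Complex.exp (2 * (Real.pi : ℂ) * Complex.I * (z + 1 / 2) * ((n : ℂ) + 1 / 2)
      + (Real.pi : ℂ) * Complex.I * τ * ((n : ℂ) + 1 / 2) ^ 2)

/-- The function `σ_λ(z) = θ₁(z−λ)θ₁′(0) / (θ₁(z)θ₁(−λ))`. -/
noncomputable def sigmaFn (τ lam z : ℂ) : ℂ :=
  theta1 τ (z - lam) * deriv (theta1 τ) 0 / (theta1 τ z * theta1 τ (-lam))

/-- The configuration set `U = {x ∈ ℂⁿ : x_i − x_j ∉ L for all i ≠ j}`. -/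
def Ugrid (n : ℕ) (τ : ℂ) : Set (Fin n → ℂ) :=
  {x | ∀ i j : Fin n, i ≠ j → x i - x j ∉ lat τ}

/-- The elliptic Dunkl operator `∇_i`. -/
noncomputable def ellDunkl (n : ℕ) (τ k : ℂ) (lam : Fin n → ℂ) (i : Fin n)
    (F : (Fin n → ℂ) → ℂ) (x : Fin n → ℂ) : ℂ :=
  fderiv ℂ F x (Pi.single i 1)
    + k * ∑ j ∈ Finset.univ.filter (fun j => j ≠ i),
        sigmaFn τ (lam i - lam j) (x i - x j) * F (x ∘ Equiv.swap i j)


lemma ed_differentiableAt_partial {n : ℕ} {F : (Fin n → ℂ) → ℂ} {U : Set (Fin n → ℂ)}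
    (hU : IsOpen U) (hF : DifferentiableOn ℂ F U) (v : Fin n → ℂ) (hv : ‖v‖ ≤ 1)
    {x₀ : Fin n → ℂ} (hx₀ : x₀ ∈ U) :
    DifferentiableAt ℂ (fun y => fderiv ℂ F y v) x₀ := by
  have hc : ContinuousAt F x₀ := (hF.continuousOn.continuousAt (hU.mem_nhds hx₀))
  have h1 : ∀ᶠ y in nhds x₀, y ∈ U ∧ F y ∈ Metric.ball (F x₀) 1 :=
    (hU.mem_nhds hx₀ |> Filter.eventually_of_mem <| fun _ h => h).and
      (hc.eventually (Metric.ball_mem_nhds _ one_pos))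
  obtain ⟨R, hR, hRb⟩ := Metric.eventually_nhds_iff_ball.1 h1
  set r := R / 4 with hr
  have hr0 : 0 < r := by positivity
  have hdA : ∀ w ∈ Metric.ball x₀ R, DifferentiableAt ℂ F w := fun w hw =>
    hF.differentiableAt (hU.mem_nhds (hRb w hw).1)
  have hbd : ∀ w ∈ Metric.ball x₀ (2 * r), ‖fderiv ℂ F w‖ ≤ 2 / r := by
    intro w hw
    have hsub : Metric.ball w r ⊆ Metric.ball x₀ R := by
      intro z hz
      rw [Metric.mem_ball] at *
      have := dist_triangle z w x₀
      linarith
    apply norm_fderiv_le_div_of_mapsTo_ball _ _ hr0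
    · intro z hz
      exact (hdA z (hsub hz)).differentiableWithinAt
    · intro z hz
      have a1 := (hRb z (hsub hz)).2
      have a2 := (hRb w (hsub (Metric.mem_ball_self hr0))).2
      rw [Metric.mem_ball] at a1 a2
      rw [Metric.mem_closedBall]
      have := dist_triangle_right (F z) (F w) (F x₀)
      linarith
  have hmem : ∀ y ∈ Metric.ball x₀ r, ∀ ζ : ℂ, ‖ζ‖ ≤ r → y + ζ • v ∈ Metric.ball x₀ (2 * r) := by
    intro y hy ζ hζ
    rw [Metric.mem_ball, dist_eq_norm] at *
    calc ‖y + ζ • v - x₀‖ = ‖(y - x₀) + ζ • v‖ := by congr 1; abel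
      _ ≤ ‖y - x₀‖ + ‖ζ‖ * ‖v‖ := (norm_add_le _ _).trans (by rw [norm_smul])
      _ < r + r * 1 := by
        apply add_lt_add_of_lt_of_le hy
        exact mul_le_mul hζ hv (norm_nonneg _) hr0.le
      _ = 2 * r := by ring
  have h2R : Metric.ball x₀ (2 * r) ⊆ Metric.ball x₀ R := Metric.ball_subset_ball (by linarith)
  have hcm : ∀ θ : ℝ, ‖circleMap 0 r θ‖ ≤ r := fun θ => by
    simp [abs_of_pos hr0]
  -- Cauchy formula
  have hcau : ∀ y ∈ Metric.ball x₀ r, fderiv ℂ F y v =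
      (2 * Real.pi * I : ℂ)⁻¹ * ∫ θ in (0:ℝ)..2 * Real.pi,
        deriv (circleMap 0 r) θ * (((circleMap 0 r θ) ^ 2)⁻¹ * F (y + circleMap 0 r θ • v)) := by
    intro y hy
    have hopen : IsOpen {ζ : ℂ | y + ζ • v ∈ Metric.ball x₀ (2 * r)} :=
      Metric.isOpen_ball.preimage (by fun_prop)
    have hdf : DifferentiableOn ℂ (fun ζ : ℂ => F (y + ζ • v))
        {ζ : ℂ | y + ζ • v ∈ Metric.ball x₀ (2 * r)} := by
      intro ζ hζ
      have := hdA _ (h2R hζ)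
      exact (DifferentiableAt.comp ζ this (by fun_prop)).differentiableWithinAt
    have := Complex.two_pi_I_inv_smul_circleIntegral_sub_sq_inv_smul_of_differentiable
      (c := 0) (w₀ := 0) (R := r) hopen (fun ζ hζ => hmem y hy ζ (by simpa using hζ)) hdf
      (Metric.mem_ball_self hr0)
    simp only [circleIntegral, smul_eq_mul, sub_zero] at this
    rw [this]
    have hy' : DifferentiableAt ℂ F (y + (0:ℂ) • v) := by
      exact hdA _ (h2R (hmem y hy 0 (by simpa using hr0.le)))
    have hl : HasDerivAt (fun ζ : ℂ => y + ζ • v) v 0 := by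
      simpa using ((hasDerivAt_id (0:ℂ)).smul_const v).const_add y
    have := (hy'.hasFDerivAt.comp_hasDerivAt (0:ℂ) hl).deriv
    simp only [zero_smul, add_zero, Function.comp_def] at this
    exact this.symm
  have hcirc0 : ∀ θ, circleMap 0 r θ ≠ 0 := fun θ => circleMap_ne_center hr0.ne'
  have hFc : ∀ y ∈ Metric.ball x₀ r, Continuous (fun θ : ℝ =>
      deriv (circleMap 0 r) θ * (((circleMap 0 r θ) ^ 2)⁻¹ * F (y + circleMap 0 r θ • v))) := by
    intro y hy
    have e1 : Continuous (fun θ : ℝ => circleMap 0 r θ) := continuous_circleMap 0 r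
    have e2 : Continuous (fun θ : ℝ => deriv (circleMap 0 r) θ) := by
      simp only [deriv_circleMap]; fun_prop
    have e3 : Continuous (fun θ : ℝ => F (y + circleMap 0 r θ • v)) := by
      rw [continuous_iff_continuousAt]
      intro θ
      exact ContinuousAt.comp (f := fun θ : ℝ => y + circleMap 0 r θ • v)
        (hdA _ (h2R (hmem y hy _ (hcm θ)))).continuousAt (by fun_prop)
    exact e2.mul ((Continuous.inv₀ (by fun_prop) (fun θ => pow_ne_zero _ (hcirc0 θ))).mul e3)
  have main := intervalIntegral.hasFDerivAt_integral_of_dominated_of_fderiv_le (𝕜 := ℂ)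
    (μ := MeasureTheory.volume) (a := 0) (b := 2 * Real.pi) (x₀ := x₀) (s := Metric.ball x₀ r)
    (F := fun y θ => deriv (circleMap 0 r) θ * (((circleMap 0 r θ) ^ 2)⁻¹ * F (y + circleMap 0 r θ • v)))
    (F' := fun y θ => deriv (circleMap 0 r) θ •
      (((circleMap 0 r θ) ^ 2)⁻¹ • fderiv ℂ F (y + circleMap 0 r θ • v)))
    (bound := fun _ => r * ((r^2)⁻¹ * (2 / r)))
    (Metric.ball_mem_nhds _ hr0) ?_ ?_ ?_ ?_ ?_ ?_
  · refine DifferentiableAt.congr_of_eventuallyEq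
      ((main.differentiableAt).const_mul ((2 * Real.pi * I : ℂ)⁻¹)) ?_
    filter_upwards [Metric.ball_mem_nhds x₀ hr0] with y hy
    exact hcau y hy
  · filter_upwards [Metric.ball_mem_nhds x₀ hr0] with y hy
    exact (hFc y hy).aestronglyMeasurable
  · exact (hFc x₀ (Metric.mem_ball_self hr0)).intervalIntegrable _ _
  · have e1 : Measurable (fun θ : ℝ => circleMap 0 r θ) := (continuous_circleMap 0 r).measurable
    have e2 : Measurable (fun θ : ℝ => deriv (circleMap 0 r) θ) := by
      simp only [deriv_circleMap]; fun_prop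
    have e3 : Measurable (fun θ : ℝ => fderiv ℂ F (x₀ + circleMap 0 r θ • v)) :=
      (measurable_fderiv ℂ F).comp
        (by have := continuous_circleMap 0 r; exact Continuous.measurable (by fun_prop))
    exact (e2.smul ((e1.pow_const 2).inv.smul e3)).aestronglyMeasurable
  · refine Filter.Eventually.of_forall fun θ _ y hy => ?_
    rw [norm_smul, norm_smul]
    have := hbd _ (hmem y hy _ (hcm θ))
    simp only [deriv_circleMap, norm_mul, norm_circleMap_zero, norm_I, mul_one, norm_inv, norm_pow,
      abs_of_pos hr0]
    gcongr
  · exact intervalIntegrable_const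
  · refine Filter.Eventually.of_forall fun θ _ y hy => ?_
    have h := (hdA _ (h2R (hmem y hy _ (hcm θ)))).hasFDerivAt
    have h' := h.comp y ((hasFDerivAt_id y).add_const (circleMap 0 r θ • v))
    exact (h'.const_smul (((circleMap 0 r θ) ^ 2)⁻¹)).const_smul (deriv (circleMap 0 r) θ)

lemma ed_differentiableAt_fderiv {n : ℕ} {F : (Fin n → ℂ) → ℂ} {U : Set (Fin n → ℂ)}
    (hU : IsOpen U) (hF : DifferentiableOn ℂ F U) {x : Fin n → ℂ} (hx : x ∈ U) :
    DifferentiableAt ℂ (fderiv ℂ F) x := by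
  have : fderiv ℂ F = fun y => ∑ i, (fderiv ℂ F y (Pi.single i 1)) •
      (ContinuousLinearMap.proj (R := ℂ) (φ := fun _ : Fin n => ℂ) i) := by
    funext y
    refine ContinuousLinearMap.ext fun v => ?_
    conv_lhs => rw [pi_eq_sum_univ' v, map_sum]
    simp only [sum_apply, smul_apply, map_smul,
      ContinuousLinearMap.proj_apply, smul_eq_mul, mul_comm]
  rw [this]
  refine DifferentiableAt.fun_sum fun i _ => ?_
  exact (ed_differentiableAt_partial hU hF (Pi.single i 1) (by
    refine (pi_norm_le_iff_of_nonneg zero_le_one).2 fun j => ?_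
    by_cases h : j = i
    · subst h; simp
    · simp [h]) hx).smul_const _

lemma ed_symm {n : ℕ} {F : (Fin n → ℂ) → ℂ} {U : Set (Fin n → ℂ)}
    (hU : IsOpen U) (hF : DifferentiableOn ℂ F U) {x : Fin n → ℂ} (hx : x ∈ U) (v w : Fin n → ℂ) :
    fderiv ℂ (fun y => fderiv ℂ F y v) x w = fderiv ℂ (fun y => fderiv ℂ F y w) x v := by
  have h := ed_differentiableAt_fderiv hU hF hx
  have e : ∀ v w, fderiv ℂ (fun y => fderiv ℂ F y v) x w = fderiv ℂ (fderiv ℂ F) x w v := by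
    intro v w
    rw [fderiv_clm_apply h (differentiableAt_const v)]
    simp
  rw [e, e]
  apply second_derivative_symmetric_of_eventually (f := F) (f' := fderiv ℂ F) (x := x) _ h.hasFDerivAt
  filter_upwards [hU.mem_nhds hx] with y hy
  exact (hF.differentiableAt (hU.mem_nhds hy)).hasFDerivAt

lemma ed_theta1_eq (τ z : ℂ) : theta1 τ z =
    -(cexp (Real.pi * I * (z + 1 / 2) + Real.pi * I * τ / 4) *
      jacobiTheta₂ (z + 1 / 2 + τ / 2) τ) := by
  rw [theta1, jacobiTheta₂, ← tsum_mul_left]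
  congr 1
  refine tsum_congr fun n => ?_
  rw [jacobiTheta₂_term, ← Complex.exp_add]
  congr 1
  ring

lemma ed_jacobi_ne (τ : ℂ) (hτ : 0 < τ.im) : ∃ z, jacobiTheta₂ z τ ≠ 0 := by
  by_contra! hz
  let f : ℤ → C(ℝ, ℂ) := fun n => ⟨fun x : ℝ => jacobiTheta₂_term n x τ, by
    unfold jacobiTheta₂_term; fun_prop⟩
  have hs : Summable fun i => ‖ContinuousMap.restrict
      (↑(⟨Set.uIcc (0:ℝ) 1, isCompact_uIcc⟩ : TopologicalSpace.Compacts ℝ)) (f i)‖ := by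
    refine Summable.of_nonneg_of_le (fun _ => norm_nonneg _) (fun i => ?_)
      ((summable_jacobiTheta₂_term_iff 0 τ).2 hτ).norm
    rw [ContinuousMap.norm_le _ (norm_nonneg _)]
    intro x
    simp only [f, ContinuousMap.restrict_apply, ContinuousMap.coe_mk]
    rw [norm_jacobiTheta₂_term, norm_jacobiTheta₂_term]
    simp
  have h := intervalIntegral.hasSum_intervalIntegral_of_summable_norm hs
  have h0 : (∫ (x : ℝ) in (0:ℝ)..1, ∑' i, (f i) x) = 0 := by
    have : ∀ x : ℝ, ∑' i, (f i) x = 0 := fun x => hz x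
    simp [this]
  rw [h0] at h
  have h1 : ∀ n : ℤ, (∫ (x : ℝ) in (0:ℝ)..1, (f n) x) = if n = 0 then 1 else 0 := by
    intro n
    by_cases hn : n = 0
    · subst hn
      simp [f, jacobiTheta₂_term]
    · rw [if_neg hn]
      simp only [f, ContinuousMap.coe_mk, jacobiTheta₂_term, Complex.exp_add]
      rw [intervalIntegral.integral_mul_const]
      have hc : (2 * Real.pi * I * n : ℂ) ≠ 0 := by
        simp [hn, Real.pi_ne_zero]
      rw [integral_exp_mul_complex hc]
      have : cexp (2 * Real.pi * I * n) = 1 := by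
        rw [mul_comm]; exact exp_int_mul_two_pi_mul_I n
      simp [this]
  simp only [h1] at h
  exact one_ne_zero ((hasSum_ite_eq (0:ℤ) (1:ℂ)).unique h)

lemma ed_theta1_ne (τ : ℂ) (hτ : 0 < τ.im) : ∃ z, theta1 τ z ≠ 0 := by
  obtain ⟨z, hz⟩ := ed_jacobi_ne τ hτ
  refine ⟨z - 1 / 2 - τ / 2, ?_⟩
  rw [ed_theta1_eq, neg_ne_zero]
  refine mul_ne_zero (exp_ne_zero _) ?_
  convert hz using 2
  ring

lemma ed_theta1_diff (τ : ℂ) (hτ : 0 < τ.im) : Differentiable ℂ (theta1 τ) := by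
  have : theta1 τ = fun z => -(cexp (Real.pi * I * (z + 1 / 2) + Real.pi * I * τ / 4) *
      jacobiTheta₂ (z + 1 / 2 + τ / 2) τ) := funext (ed_theta1_eq τ)
  rw [this]
  intro z
  refine DifferentiableAt.neg (DifferentiableAt.mul (by fun_prop) ?_)
  exact DifferentiableAt.comp (g := fun w => jacobiTheta₂ w τ) z
    (differentiableAt_jacobiTheta₂_fst _ hτ) (by fun_prop)

lemma ed_theta1_neg (τ z : ℂ) : theta1 τ (-z) = -theta1 τ z := by
  rw [ed_theta1_eq, ed_theta1_eq, neg_neg,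
    show -z + 1 / 2 + τ / 2 = -((z + 1 / 2 - τ / 2 ) - 1) by ring, jacobiTheta₂_neg_left]
  have h1 := jacobiTheta₂_add_left (z + 1 / 2 - τ / 2 - 1) τ
  have h2 := jacobiTheta₂_add_left' (z + 1 / 2 - τ / 2) τ
  rw [sub_add_cancel] at h1
  rw [← h1, show z + 1 / 2 + τ / 2 = z + 1 / 2 - τ / 2 + τ by ring, h2, ← mul_assoc,
    ← Complex.exp_add, ← neg_mul]
  congr 1
  have h3 : (-1 : ℂ) = cexp (Real.pi * I) := exp_pi_mul_I.symm
  rw [← neg_one_mul (cexp _), h3, ← Complex.exp_add]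
  rw [Complex.exp_eq_exp_iff_exists_int]
  refine ⟨1, ?_⟩
  push_cast
  ring

lemma ed_theta1_zero (τ : ℂ) : theta1 τ 0 = 0 := by
  have := ed_theta1_neg τ 0
  rw [neg_zero] at this
  linear_combination this / 2

lemma ed_theta1_add_one (τ z : ℂ) : theta1 τ (z + 1) = - theta1 τ z := by
  rw [ed_theta1_eq, ed_theta1_eq, show z + 1 + 1 / 2 + τ / 2 = z + 1 / 2 + τ / 2 + 1 by ring,
    jacobiTheta₂_add_left, ← neg_mul]
  rw [show Real.pi * I * (z + 1 + 1 / 2) + Real.pi * I * τ / 4 =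
    (Real.pi * I * (z + 1 / 2) + Real.pi * I * τ / 4) + Real.pi * I by ring, Complex.exp_add,
    exp_pi_mul_I]
  ring

lemma ed_theta1_add_tau (τ z : ℂ) : ∃ c : ℂ, c ≠ 0 ∧ theta1 τ (z + τ) = c * theta1 τ z := by
  refine ⟨cexp (Real.pi * I * τ) * cexp (-Real.pi * I * (τ + 2 * (z + 1 / 2 + τ / 2))),
    mul_ne_zero (exp_ne_zero _) (exp_ne_zero _), ?_⟩
  rw [ed_theta1_eq, ed_theta1_eq, show z + τ + 1 / 2 + τ / 2 = z + 1 / 2 + τ / 2 + τ by ring,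
    jacobiTheta₂_add_left']
  rw [show Real.pi * I * (z + τ + 1 / 2) + Real.pi * I * τ / 4 =
    (Real.pi * I * (z + 1 / 2) + Real.pi * I * τ / 4) + Real.pi * I * τ by ring, Complex.exp_add]
  ring

lemma ed_theta1_lat (τ w : ℂ) (hw : w ∈ lat τ) : theta1 τ w = 0 := by
  obtain ⟨m, n, rfl⟩ := hw
  have A : ∀ z, theta1 τ z = 0 ↔ theta1 τ (z + τ) = 0 := fun z => by
    obtain ⟨c, hc, h⟩ := ed_theta1_add_tau τ z
    simp [h, hc]
  have B : ∀ z, theta1 τ z = 0 ↔ theta1 τ (z + 1) = 0 := fun z => by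
    simp [ed_theta1_add_one]
  have h1 : ∀ n : ℤ, theta1 τ (n * τ) = 0 := by
    intro n
    induction n using Int.induction_on with
    | zero => simpa using ed_theta1_zero τ
    | succ i ih => push_cast at *; rw [add_mul, one_mul]; exact (A _).1 ih
    | pred i ih => push_cast at *; rw [A]; convert ih using 2; ring
  induction m using Int.induction_on with
  | zero => simpa using h1 n
  | succ i ih => push_cast at *; rw [add_right_comm]; exact (B _).1 ih
  | pred i ih => push_cast at *; rw [B]; convert ih using 2; ring

/-- even part -/
noncomputable def edE (τ x : ℂ) : ℂ := jacobiTheta₂ (2 * x) (2 * τ)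
/-- odd part -/
noncomputable def edO (τ x : ℂ) : ℂ :=
  cexp (2 * Real.pi * I * x + Real.pi * I * τ / 2) * jacobiTheta₂ (2 * x + τ) (2 * τ)

lemma ed_im2 {τ : ℂ} (hτ : 0 < τ.im) : 0 < (2 * τ).im := by
  simp; exact hτ

lemma edE_diff (τ : ℂ) (hτ : 0 < τ.im) : Differentiable ℂ (edE τ) := fun x =>
  DifferentiableAt.comp (g := fun w => jacobiTheta₂ w (2 * τ)) x
    (differentiableAt_jacobiTheta₂_fst _ (ed_im2 hτ)) (by fun_prop)

lemma edO_diff (τ : ℂ) (hτ : 0 < τ.im) : Differentiable ℂ (edO τ) := fun x =>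
  DifferentiableAt.mul (by fun_prop) (DifferentiableAt.comp (g := fun w => jacobiTheta₂ w (2 * τ)) x
    (differentiableAt_jacobiTheta₂_fst _ (ed_im2 hτ)) (by fun_prop))

lemma edE_half (τ x : ℂ) : edE τ (x + 1 / 2) = edE τ x := by
  rw [edE, edE, ← jacobiTheta₂_add_left (2 * x)]; congr 1; ring

lemma edO_half (τ x : ℂ) : edO τ (x + 1 / 2) = -edO τ x := by
  rw [edO, edO, show 2 * (x + 1 / 2) + τ = 2 * x + τ + 1 by ring, jacobiTheta₂_add_left,
    show 2 * Real.pi * I * (x + 1 / 2) + Real.pi * I * τ / 2 =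
      2 * Real.pi * I * x + Real.pi * I * τ / 2 + Real.pi * I by ring, Complex.exp_add,
      exp_pi_mul_I]
  ring

lemma edE_tau (τ x : ℂ) : edE τ (x + τ / 2) =
    cexp (-(2 * Real.pi * I * x + Real.pi * I * τ / 2)) * edO τ x := by
  rw [edE, edO, ← mul_assoc, ← Complex.exp_add, neg_add_cancel, Complex.exp_zero, one_mul]
  congr 1; ring

lemma edO_tau (τ x : ℂ) : edO τ (x + τ / 2) =
    cexp (-(2 * Real.pi * I * x + Real.pi * I * τ / 2)) * edE τ x := by
  rw [edE, edO, show 2 * (x + τ / 2) + τ = 2 * x + 2 * τ by ring, jacobiTheta₂_add_left',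
    ← mul_assoc, ← Complex.exp_add]
  congr 2; ring

lemma ed_neg_one_zpow (M : ℤ) : cexp (2 * Real.pi * I * M) = 1 := by
  rw [mul_comm]; exact exp_int_mul_two_pi_mul_I M

lemma ed_reindex (f : ℤ × ℤ → ℂ) (A B : ℂ)
    (h1 : HasSum (fun p : ℤ × ℤ => f (p.1 + p.2, p.1 - p.2 - 1)) A)
    (h2 : HasSum (fun p : ℤ × ℤ => f (p.1 + p.2, p.1 - p.2)) B) : HasSum f (A + B) := by
  let g1 : ℤ × ℤ → ℤ × ℤ := fun p => (p.1 + p.2, p.1 - p.2 - 1)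
  let g2 : ℤ × ℤ → ℤ × ℤ := fun p => (p.1 + p.2, p.1 - p.2)
  have i1 : Function.Injective g1 := by
    rintro ⟨a, b⟩ ⟨c, d⟩ h
    simp only [g1, Prod.mk.injEq] at h ⊢; omega
  have i2 : Function.Injective g2 := by
    rintro ⟨a, b⟩ ⟨c, d⟩ h
    simp only [g2, Prod.mk.injEq] at h ⊢; omega
  have hcompl : IsCompl (Set.range g1) (Set.range g2) := by
    rw [isCompl_iff, Set.disjoint_iff, codisjoint_iff]
    constructor
    · rintro _ ⟨⟨⟨a, b⟩, rfl⟩, ⟨⟨c, d⟩, h⟩⟩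
      simp only [g1, g2, Prod.mk.injEq] at h
      exfalso; omega
    · change Set.range g1 ∪ Set.range g2 = Set.univ
      ext ⟨a, b⟩
      simp only [Set.mem_union, Set.mem_range, g1, g2, Prod.exists, Prod.mk.injEq, Set.mem_univ,
        iff_true]
      rcases Int.even_or_odd' (a + b) with ⟨k, hk | hk⟩
      · right; exact ⟨k, a - k, by omega, by omega⟩
      · left; exact ⟨k + 1, a - k - 1, by omega, by omega⟩
  exact HasSum.add_isCompl hcompl (i1.hasSum_range_iff.2 h1) (i2.hasSum_range_iff.2 h2)

/-- The key product formula. -/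
lemma ed_product (τ : ℂ) (hτ : 0 < τ.im) (x y : ℂ) :
    theta1 τ (x + y) * theta1 τ (x - y) = edE τ x * edO τ y - edO τ x * edE τ y := by
  let t : ℂ → ℤ → ℂ := fun z n =>
    cexp (2 * (Real.pi : ℂ) * Complex.I * (z + 1 / 2) * ((n : ℂ) + 1 / 2)
      + (Real.pi : ℂ) * Complex.I * τ * ((n : ℂ) + 1 / 2) ^ 2)
  let e : ℂ → ℤ → ℂ := fun z n => cexp (2 * Real.pi * I * (2 * n) * z + Real.pi * I * τ * (2 * n) ^ 2 / 2)
  let o : ℂ → ℤ → ℂ := fun z n =>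
    cexp (2 * Real.pi * I * (2 * n + 1) * z + Real.pi * I * τ * (2 * n + 1) ^ 2 / 2)
  have hsum := fun z => (summable_jacobiTheta₂_term_iff z τ).2 hτ
  have hsum2 := fun z => (summable_jacobiTheta₂_term_iff z (2 * τ)).2 (ed_im2 hτ)
  have ht : ∀ z, Summable (fun n => ‖t z n‖) := fun z => by
    have := ((hsum (z + 1 / 2 + τ / 2)).mul_left
      (cexp (Real.pi * I * (z + 1 / 2) + Real.pi * I * τ / 4))).norm
    refine this.congr fun n => ?_
    congr 1
    rw [jacobiTheta₂_term, ← Complex.exp_add]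
    simp only [t]; congr 1; ring
  have heq : ∀ z n, e z n = jacobiTheta₂_term n (2 * z) (2 * τ) := fun z n => by
    simp only [e, jacobiTheta₂_term]; congr 1; ring
  have hoq : ∀ z n, o z n = cexp (2 * Real.pi * I * z + Real.pi * I * τ / 2) *
      jacobiTheta₂_term n (2 * z + τ) (2 * τ) := fun z n => by
    simp only [o, jacobiTheta₂_term]; rw [← Complex.exp_add]; congr 1; ring
  have he : ∀ z, Summable (fun n => ‖e z n‖) := fun z => by
    simp only [heq]; exact (hsum2 _).norm
  have ho : ∀ z, Summable (fun n => ‖o z n‖) := fun z => by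
    simp only [hoq]; exact ((hsum2 _).mul_left _).norm
  have hE : ∀ z, edE τ z = ∑' n, e z n := fun z => by
    simp only [heq]; rfl
  have hO : ∀ z, edO τ z = ∑' n, o z n := fun z => by
    simp only [hoq]; rw [tsum_mul_left]; rfl
  have hL : theta1 τ (x + y) * theta1 τ (x - y) = (∑' n, t (x + y) n) * ∑' n, t (x - y) n := by
    simp only [theta1, t]; ring
  rw [hL, hE, hE, hO, hO, tsum_mul_tsum_of_summable_norm (ht _) (ht _),
    tsum_mul_tsum_of_summable_norm (he _) (ho _), tsum_mul_tsum_of_summable_norm (ho _) (he _),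
    sub_eq_add_neg (∑' z : ℤ × ℤ, _), ← tsum_neg]
  have S1 := summable_mul_of_summable_norm (he x) (ho y)
  have S2 := (summable_mul_of_summable_norm (ho x) (he y)).neg
  refine HasSum.tsum_eq (ed_reindex _ _ _ ?_ ?_)
  · refine (congrArg (fun f : ℤ × ℤ → ℂ => HasSum f _) (funext ?_)).mpr S1.hasSum
    rintro ⟨p, r⟩
    simp only [t, e, o]
    rw [← Complex.exp_add, ← Complex.exp_add, Complex.exp_eq_exp_iff_exists_int]
    refine ⟨p, ?_⟩
    push_cast; ring
  · refine (congrArg (fun f : ℤ × ℤ → ℂ => HasSum f _) (funext ?_)).mpr S2.hasSum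
    rintro ⟨p, r⟩
    simp only [t, e, o]
    rw [← Complex.exp_add, ← Complex.exp_add, ← neg_one_mul, ← exp_pi_mul_I, ← Complex.exp_add,
      Complex.exp_eq_exp_iff_exists_int]
    refine ⟨p, ?_⟩
    push_cast; ring

lemma ed_weierstrass (τ : ℂ) (hτ : 0 < τ.im) (u v a b : ℂ) :
    theta1 τ (u - a) * theta1 τ (a + b) * (theta1 τ (u + v - b) * theta1 τ v)
      - theta1 τ u * theta1 τ b * (theta1 τ (u + v - a - b) * theta1 τ (v + a))
      - theta1 τ (u + v) * theta1 τ (v - b) * (theta1 τ (u - a - b) * theta1 τ a) = 0 := by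
  have P := ed_product τ hτ
  have p1 := P ((u + b) / 2) ((u - b) / 2 - a)
  have p2 := P ((u - b) / 2) ((u - b) / 2 + v)
  have p3 := P ((u + b) / 2) ((u - b) / 2)
  have p4 := P ((u - b) / 2 - a) ((u - b) / 2 + v)
  have p5 := P ((u + b) / 2) ((u - b) / 2 + v)
  have p6 := P ((u - b) / 2 - a) ((u - b) / 2)
  rw [show (u + b) / 2 + ((u - b) / 2 - a) = u - a by ring,
    show (u + b) / 2 - ((u - b) / 2 - a) = a + b by ring] at p1
  rw [show (u - b) / 2 + ((u - b) / 2 + v) = u + v - b by ring,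
    show (u - b) / 2 - ((u - b) / 2 + v) = -v by ring, ed_theta1_neg] at p2
  rw [show (u + b) / 2 + ((u - b) / 2) = u by ring,
    show (u + b) / 2 - ((u - b) / 2) = b by ring] at p3
  rw [show (u - b) / 2 - a + ((u - b) / 2 + v) = u + v - a - b by ring,
    show (u - b) / 2 - a - ((u - b) / 2 + v) = -(v + a) by ring, ed_theta1_neg] at p4
  rw [show (u + b) / 2 + ((u - b) / 2 + v) = u + v by ring,
    show (u + b) / 2 - ((u - b) / 2 + v) = -(v - b) by ring, ed_theta1_neg] at p5
  rw [show (u - b) / 2 - a + ((u - b) / 2) = u - a - b by ring,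
    show (u - b) / 2 - a - ((u - b) / 2) = -a by ring, ed_theta1_neg] at p6
  rw [mul_neg, neg_eq_iff_eq_neg] at p2 p4 p5 p6
  rw [p1, p2, p3, p4, p5, p6]
  ring

lemma ed_no_common_zero (τ : ℂ) (hτ : 0 < τ.im) (x : ℂ) : edE τ x ≠ 0 ∨ edO τ x ≠ 0 := by
  by_contra! h
  have hT := ed_theta1_diff τ hτ
  have h0 : ∀ y ∈ (Set.univ : Set ℂ), theta1 τ (x + y) * theta1 τ (x - y) = 0 := fun y _ => by
    rw [ed_product τ hτ, h.1, h.2]; ring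
  have d1 : Differentiable ℂ (fun y => theta1 τ (x + y)) := hT.comp (by fun_prop)
  have d2 : Differentiable ℂ (fun y => theta1 τ (x - y)) := hT.comp (by fun_prop)
  obtain ⟨z, hz⟩ := ed_theta1_ne τ hτ
  rcases AnalyticOnNhd.eq_zero_or_eq_zero_of_mul_eq_zero (fun y _ => d1.analyticAt y)
    (fun y _ => d2.analyticAt y) h0 isPreconnected_univ with h | h
  · exact hz (by simpa using h (z - x) trivial)
  · exact hz (by simpa using h (x - z) trivial)

lemma ed_liouville (τ : ℂ) (hτ : 0 < τ.im) (g : ℂ → ℂ) (hg : Differentiable ℂ g)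
    (h1 : ∀ x, g (x + 1 / 2) = g x) (h2 : ∀ x, g (x + τ / 2) = g x) (z w : ℂ) : g z = g w := by
  have p1 : Function.Periodic g (1 / 2) := h1
  have p2 : Function.Periodic g (τ / 2) := h2
  apply hg.apply_eq_apply_of_bounded
  let φ : ℝ × ℝ → ℂ := fun p => p.1 * (1 / 2) + p.2 * (τ / 2)
  have hφ : Continuous φ := by fun_prop
  have hK : IsCompact (g '' (φ '' (Set.Icc 0 1 ×ˢ Set.Icc 0 1))) :=
    ((isCompact_Icc.prod isCompact_Icc).image hφ).image hg.continuous
  refine hK.isBounded.subset ?_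
  rintro _ ⟨z, rfl⟩
  set t : ℝ := 2 * (z.im / τ.im) with ht
  set s : ℝ := 2 * (z.re - z.im / τ.im * τ.re) with hs
  have hz : z = s * (1 / 2) + t * (τ / 2) := by
    apply Complex.ext
    · simp [hs, ht]; ring
    · simp [hs, ht]; field_simp
  refine ⟨_, ⟨(Int.fract s, Int.fract t), ⟨⟨Int.fract_nonneg _, (Int.fract_lt_one _).le⟩,
    ⟨Int.fract_nonneg _, (Int.fract_lt_one _).le⟩⟩, rfl⟩, ?_⟩
  have e : z = φ (Int.fract s, Int.fract t) + (⌊s⌋ : ℤ) * (1 / 2 : ℂ) + (⌊t⌋ : ℤ) * (τ / 2) := by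
    simp only [φ]
    conv_lhs => rw [hz, ← Int.fract_add_floor s, ← Int.fract_add_floor t]
    push_cast; ring
  rw [e, p2.int_mul ⌊t⌋, p1.int_mul ⌊s⌋]

lemma ed_zero_mem (τ : ℂ) (hτ : 0 < τ.im) (c : ℂ) (hc : theta1 τ c = 0) : c ∈ lat τ := by
  have hE := edE_diff τ hτ
  have hO := edO_diff τ hτ
  have hcr : ∀ x, edE τ (x + c) * edO τ x = edO τ (x + c) * edE τ x := fun x => by
    have := ed_product τ hτ (x + c) x
    rw [show x + c - x = c by ring, hc] at this
    linear_combination -this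
  have hex : ∀ x, ∃ γ, γ * edE τ x = edE τ (x + c) ∧ γ * edO τ x = edO τ (x + c) := fun x => by
    rcases ed_no_common_zero τ hτ x with h | h
    · refine ⟨edE τ (x + c) / edE τ x, by field_simp, ?_⟩
      rw [div_mul_eq_mul_div, hcr]; field_simp
    · refine ⟨edO τ (x + c) / edO τ x, ?_, by field_simp⟩
      rw [div_mul_eq_mul_div, ← hcr]; field_simp
  choose γ hγE hγO using hex
  have huniq : ∀ x a, a * edE τ x = edE τ (x + c) → a * edO τ x = edO τ (x + c) → γ x = a := by
    intro x a h1 h2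
    rcases ed_no_common_zero τ hτ x with h | h
    · exact mul_right_cancel₀ h ((hγE x).trans h1.symm)
    · exact mul_right_cancel₀ h ((hγO x).trans h2.symm)
  have hγ0 : ∀ x, γ x ≠ 0 := fun x h => by
    have h1 := hγE x
    have h2 := hγO x
    rw [h, zero_mul] at h1 h2
    rcases ed_no_common_zero τ hτ (x + c) with h | h
    · exact h h1.symm
    · exact h h2.symm
  have hγd : Differentiable ℂ γ := fun x => by
    have hE' : Differentiable ℂ (fun x => edE τ (x + c)) := hE.comp (by fun_prop)
    have hO' : Differentiable ℂ (fun x => edO τ (x + c)) := hO.comp (by fun_prop)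
    rcases ed_no_common_zero τ hτ x with h | h
    · refine DifferentiableAt.congr_of_eventuallyEq ((hE' x).div (hE x) h) ?_
      filter_upwards [(hE x).continuousAt.eventually_ne h] with y hy
      exact eq_div_of_mul_eq hy (hγE y)
    · refine DifferentiableAt.congr_of_eventuallyEq ((hO' x).div (hO x) h) ?_
      filter_upwards [(hO x).continuousAt.eventually_ne h] with y hy
      exact eq_div_of_mul_eq hy (hγO y)
  have hp1 : ∀ x, γ (x + 1 / 2) = γ x := fun x => by
    apply huniq
    · rw [edE_half, hγE, add_right_comm, edE_half]
    · rw [edO_half, mul_neg, hγO, add_right_comm, edO_half]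
  have hp2 : ∀ x, γ (x + τ / 2) = cexp (-(2 * Real.pi * I * c)) * γ x := fun x => by
    apply huniq
    · rw [edE_tau, add_right_comm, edE_tau, ← hγO,
        show -(2 * Real.pi * I * (x + c) + Real.pi * I * τ / 2) =
          -(2 * Real.pi * I * x + Real.pi * I * τ / 2) + -(2 * Real.pi * I * c) by ring,
        Complex.exp_add]
      ring
    · rw [edO_tau, add_right_comm, edO_tau, ← hγE,
        show -(2 * Real.pi * I * (x + c) + Real.pi * I * τ / 2) =
          -(2 * Real.pi * I * x + Real.pi * I * τ / 2) + -(2 * Real.pi * I * c) by ring,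
        Complex.exp_add]
      ring
  have hd1 : ∀ x, deriv γ (x + 1 / 2) = deriv γ x := fun x => by
    rw [← deriv_comp_add_const, funext hp1]
  have hd2 : ∀ x, deriv γ (x + τ / 2) = cexp (-(2 * Real.pi * I * c)) * deriv γ x := fun x => by
    rw [← deriv_comp_add_const, funext hp2, deriv_const_mul _ (hγd x)]
  have hL := ed_liouville τ hτ (fun x => deriv γ x / γ x) (hγd.deriv.div hγd hγ0)
    (fun x => by simp only [hp1, hd1])
    (fun x => by simp only [hp2, hd2]; rw [mul_div_mul_left _ _ (exp_ne_zero _)])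
  set κ := deriv γ 0 / γ 0 with hκ
  have hder : ∀ x, deriv γ x = κ * γ x := fun x => by
    have := hL x 0
    rw [← hκ, div_eq_iff (hγ0 x)] at this
    exact this
  have hconst := is_const_of_deriv_eq_zero (f := fun x => γ x * cexp (-(κ * x)))
    (hγd.mul (by fun_prop)) (fun x => by
      have h1 : HasDerivAt (fun x => cexp (-(κ * x))) (cexp (-(κ * x)) * (-(κ * 1))) x :=
        (((hasDerivAt_id x).const_mul κ).neg).cexp
      have h2 := ((hγd x).hasDerivAt.mul h1).deriv
      refine Eq.trans h2 ?_
      rw [hder]; ring)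
  have e1 : cexp (-(κ * (1 / 2))) = 1 := by
    have h := hconst (0 + 1 / 2) 0
    simp only [hp1] at h
    have := mul_left_cancel₀ (hγ0 0) h
    simpa using this
  have e2 : cexp (-(2 * Real.pi * I * c) + -(κ * (τ / 2))) = 1 := by
    have h := hconst (0 + τ / 2) 0
    simp only [hp2] at h
    rw [mul_assoc, mul_left_comm] at h
    have := mul_left_cancel₀ (hγ0 0) h
    rw [← Complex.exp_add] at this
    simpa using this
  obtain ⟨r, hr⟩ := Complex.exp_eq_one_iff.1 e1
  obtain ⟨s, hs⟩ := Complex.exp_eq_one_iff.1 e2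
  refine ⟨-s, r, ?_⟩
  have hpi : (2 * Real.pi * I : ℂ) ≠ 0 := two_pi_I_ne_zero
  apply mul_left_cancel₀ hpi
  push_cast
  linear_combination -hs + hr * τ

lemma ed_lat_iff (τ : ℂ) (hτ : 0 < τ.im) (c : ℂ) : theta1 τ c = 0 ↔ c ∈ lat τ :=
  ⟨ed_zero_mem τ hτ c, ed_theta1_lat τ c⟩

lemma ed_sigma_diff (τ : ℂ) (hτ : 0 < τ.im) (l z : ℂ) (hz : z ∉ lat τ) (hl : l ∉ lat τ) :
    DifferentiableAt ℂ (sigmaFn τ l) z := by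
  have hT := ed_theta1_diff τ hτ
  have h1 : Differentiable ℂ (fun z => theta1 τ (z - l)) := hT.comp (by fun_prop)
  refine DifferentiableAt.div ((h1 z).mul_const _) ((hT z).mul_const _) (mul_ne_zero ?_ ?_)
  · rwa [Ne, ed_lat_iff τ hτ]
  · rwa [ed_theta1_neg, neg_ne_zero, Ne, ed_lat_iff τ hτ]

lemma ed_sigma_neg (τ l z : ℂ) : sigmaFn τ (-l) (-z) = - sigmaFn τ l z := by
  simp only [sigmaFn, neg_neg]
  rw [show -z - -l = -(z - l) by ring, ed_theta1_neg, ed_theta1_neg τ z, ed_theta1_neg τ l]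
  rw [neg_mul, neg_mul, mul_neg, neg_div]

lemma ed_fay (τ : ℂ) (hτ : 0 < τ.im) (u v a b : ℂ) (hu : u ∉ lat τ) (hv : v ∉ lat τ)
    (huv : u + v ∉ lat τ) (ha : a ∉ lat τ) (hb : b ∉ lat τ) (hab : a + b ∉ lat τ) :
    sigmaFn τ (a + b) (u + v) * sigmaFn τ (-a) v + sigmaFn τ a u * sigmaFn τ b (u + v)
      = sigmaFn τ b v * sigmaFn τ (a + b) u := by
  rw [← ed_lat_iff τ hτ] at *
  have W := ed_weierstrass τ hτ u v a b
  simp only [sigmaFn, ed_theta1_neg, neg_neg, sub_neg_eq_add, ← sub_sub]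
  field_simp
  linear_combination (deriv (theta1 τ) 0) ^ 2 * W

lemma ed_open (n : ℕ) (τ : ℂ) (hτ : 0 < τ.im) : IsOpen (Ugrid n τ) := by
  have : Ugrid n τ = ⋂ i : Fin n, ⋂ j : Fin n, ⋂ (_ : i ≠ j),
      {x : Fin n → ℂ | theta1 τ (x i - x j) ≠ 0} := by
    ext x
    simp only [Ugrid, Set.mem_setOf_eq, Set.mem_iInter, Ne, ed_lat_iff τ hτ]
  rw [this]
  refine isOpen_iInter_of_finite fun i => isOpen_iInter_of_finite fun j =>
    isOpen_iInter_of_finite fun _ => ?_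
  have hc : Continuous (fun x : Fin n → ℂ => theta1 τ (x i - x j)) :=
    (ed_theta1_diff τ hτ).continuous.comp (by fun_prop)
  exact isOpen_ne_fun hc continuous_const

lemma ed_perm_mem {n : ℕ} {τ : ℂ} {x : Fin n → ℂ} (hx : x ∈ Ugrid n τ) (σ : Equiv.Perm (Fin n)) :
    x ∘ σ ∈ Ugrid n τ := fun i j hij => hx (σ i) (σ j) (σ.injective.ne hij)

lemma ed_shift_mem {n : ℕ} {τ : ℂ} {x : Fin n → ℂ} (hx : x ∈ Ugrid n τ) (a : ℂ) :
    (fun l => x l + a) ∈ Ugrid n τ := fun i j hij => by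
  simpa using hx i j hij

/-- Permutation of coordinates as a continuous linear map. -/
noncomputable def edPerm {n : ℕ} (σ : Equiv.Perm (Fin n)) : (Fin n → ℂ) →L[ℂ] (Fin n → ℂ) :=
  ContinuousLinearMap.pi fun i => ContinuousLinearMap.proj (R := ℂ) (φ := fun _ : Fin n => ℂ) (σ i)

lemma edPerm_apply {n : ℕ} (σ : Equiv.Perm (Fin n)) (x : Fin n → ℂ) : edPerm σ x = x ∘ σ := rfl

lemma edPerm_single {n : ℕ} (σ : Equiv.Perm (Fin n)) (i : Fin n) :
    edPerm σ (Pi.single i 1) = Pi.single (σ.symm i) 1 := by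
  rw [edPerm_apply]
  funext j
  simp [Pi.single_apply, Equiv.eq_symm_apply]

section
variable {n : ℕ} {τ : ℂ} (hτ : 0 < τ.im) (k : ℂ) {lam : Fin n → ℂ}
  (hlam : ∀ i j : Fin n, i ≠ j → lam i - lam j ∉ lat τ)
  {F : (Fin n → ℂ) → ℂ} (hF : DifferentiableOn ℂ F (Ugrid n τ))

lemma ed_term_hasFDerivAt (hτ : 0 < τ.im)
    (hlam : ∀ i j : Fin n, i ≠ j → lam i - lam j ∉ lat τ)
    (hF : DifferentiableOn ℂ F (Ugrid n τ))
    {x : Fin n → ℂ} (hx : x ∈ Ugrid n τ) (j l : Fin n) (hjl : l ≠ j) :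
    HasFDerivAt (fun y : Fin n → ℂ =>
      sigmaFn τ (lam j - lam l) (y j - y l) * F (y ∘ Equiv.swap j l))
      (sigmaFn τ (lam j - lam l) (x j - x l) •
          ((fderiv ℂ F (x ∘ Equiv.swap j l)).comp (edPerm (Equiv.swap j l))) +
        F (x ∘ Equiv.swap j l) • (deriv (sigmaFn τ (lam j - lam l)) (x j - x l) •
          (ContinuousLinearMap.proj (R := ℂ) (φ := fun _ : Fin n => ℂ) j -
            ContinuousLinearMap.proj (R := ℂ) (φ := fun _ : Fin n => ℂ) l))) x := by
  have h1 : HasFDerivAt (fun y : Fin n → ℂ => y j - y l)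
      (ContinuousLinearMap.proj (R := ℂ) (φ := fun _ : Fin n => ℂ) j -
            ContinuousLinearMap.proj (R := ℂ) (φ := fun _ : Fin n => ℂ) l) x :=
    (ContinuousLinearMap.proj (R := ℂ) (φ := fun _ : Fin n => ℂ) j -
            ContinuousLinearMap.proj (R := ℂ) (φ := fun _ : Fin n => ℂ) l).hasFDerivAt
  have h2 := (ed_sigma_diff τ hτ _ _ (hx j l hjl.symm) (hlam j l hjl.symm)).hasDerivAt
  have h3 := h2.comp_hasFDerivAt x h1
  have h4 : HasFDerivAt F (fderiv ℂ F (x ∘ Equiv.swap j l)) (edPerm (Equiv.swap j l) x) :=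
    (hF.differentiableAt ((ed_open n τ hτ).mem_nhds (ed_perm_mem hx _))).hasFDerivAt
  have h5 := h4.comp x (edPerm (Equiv.swap j l)).hasFDerivAt
  exact h3.mul h5

lemma ed_hasFDerivAt (hτ : 0 < τ.im)
    (hlam : ∀ i j : Fin n, i ≠ j → lam i - lam j ∉ lat τ)
    (hF : DifferentiableOn ℂ F (Ugrid n τ))
    {x : Fin n → ℂ} (hx : x ∈ Ugrid n τ) (j : Fin n) :
    HasFDerivAt (ellDunkl n τ k lam j F)
      (fderiv ℂ (fun y => fderiv ℂ F y (Pi.single j 1)) x +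
        k • ∑ l ∈ Finset.univ.filter (fun l => l ≠ j),
      (sigmaFn τ (lam j - lam l) (x j - x l) •
          ((fderiv ℂ F (x ∘ Equiv.swap j l)).comp (edPerm (Equiv.swap j l))) +
        F (x ∘ Equiv.swap j l) • (deriv (sigmaFn τ (lam j - lam l)) (x j - x l) •
          (ContinuousLinearMap.proj (R := ℂ) (φ := fun _ : Fin n => ℂ) j -
            ContinuousLinearMap.proj (R := ℂ) (φ := fun _ : Fin n => ℂ) l)))) x := by
  have hU := ed_open n τ hτ
  have h1 : DifferentiableAt ℂ (fun y => fderiv ℂ F y (Pi.single j 1)) x :=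
    (ed_differentiableAt_fderiv hU hF hx).clm_apply (differentiableAt_const _)
  refine h1.hasFDerivAt.add (HasFDerivAt.const_mul ?_ k)
  refine HasFDerivAt.fun_sum fun l hl => ?_
  exact ed_term_hasFDerivAt hτ hlam hF hx j l (by simpa using hl)

lemma ed_fderiv_apply (hτ : 0 < τ.im)
    (hlam : ∀ i j : Fin n, i ≠ j → lam i - lam j ∉ lat τ)
    (hF : DifferentiableOn ℂ F (Ugrid n τ))
    {x : Fin n → ℂ} (hx : x ∈ Ugrid n τ) (i j : Fin n) :
    fderiv ℂ (ellDunkl n τ k lam j F) x (Pi.single i 1) =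
      fderiv ℂ (fun y => fderiv ℂ F y (Pi.single j 1)) x (Pi.single i 1) +
        k * ∑ l ∈ Finset.univ.filter (fun l => l ≠ j),
      (sigmaFn τ (lam j - lam l) (x j - x l) *
          (fderiv ℂ F (x ∘ Equiv.swap j l) (Pi.single (Equiv.swap j l i) 1)) +
        F (x ∘ Equiv.swap j l) * (deriv (sigmaFn τ (lam j - lam l)) (x j - x l) *
          ((Pi.single i 1 : Fin n → ℂ) j - (Pi.single i 1 : Fin n → ℂ) l))) := by
  rw [(ed_hasFDerivAt k hτ hlam hF hx j).fderiv]
  simp only [add_apply, smul_apply, sum_apply, sub_apply, ContinuousLinearMap.comp_apply,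
    edPerm_single, Equiv.symm_swap, smul_eq_mul, ContinuousLinearMap.proj_apply]

lemma ed_split (i j : Fin n) (hij : i ≠ j) (f : Fin n → ℂ) :
    ∑ l ∈ Finset.univ.filter (fun l => l ≠ j), f l =
      f i + ∑ l ∈ Finset.univ.filter (fun l => l ≠ i ∧ l ≠ j), f l := by
  rw [← Finset.sum_insert (by simp)]
  refine Finset.sum_congr ?_ fun _ _ => rfl
  ext l
  simp only [Finset.mem_filter, Finset.mem_univ, true_and, Finset.mem_insert]
  by_cases h : l = i
  · subst h; simp [hij]
  · simp [h]

lemma ed_split' (i j : Fin n) (hij : i ≠ j) (f : Fin n → ℂ) :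
    ∑ l ∈ Finset.univ.filter (fun l => l ≠ i), f l =
      f j + ∑ l ∈ Finset.univ.filter (fun l => l ≠ i ∧ l ≠ j), f l := by
  rw [ed_split j i hij.symm]
  simp only [and_comm]

lemma ed_sumQ (i j : Fin n) (hij : i ≠ j) (Q Q' : Fin n → Fin n → ℂ) (h0 : Q j i = Q' i j)
    (hoff : ∀ m l, m ≠ i → m ≠ j → l ≠ i → l ≠ j → m ≠ l → Q m l = Q' l m)
    (hdiag : ∀ m, m ≠ i → m ≠ j → Q j m + Q m i + Q m m = Q' i m + Q' m j + Q' m m) :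
    ∑ m ∈ Finset.univ.filter (fun m => m ≠ i), ∑ l ∈ Finset.univ.filter (fun l => l ≠ j), Q m l =
    ∑ m ∈ Finset.univ.filter (fun m => m ≠ j), ∑ l ∈ Finset.univ.filter (fun l => l ≠ i), Q' m l := by
  simp only [ed_split i j hij, ed_split' i j hij, Finset.sum_add_distrib]
  set R := Finset.univ.filter (fun l : Fin n => l ≠ i ∧ l ≠ j) with hR
  have hRm : ∀ m, m ∈ R ↔ m ≠ i ∧ m ≠ j := fun m => by simp [hR]
  have h1 : ∑ m ∈ R, ∑ l ∈ R, (Q m l - Q' l m) = ∑ m ∈ R, (Q m m - Q' m m) := by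
    refine Finset.sum_congr rfl fun m hm => ?_
    refine Finset.sum_eq_single m (fun l hl hlm => ?_) (fun h => absurd hm h)
    rw [hRm] at hm hl
    rw [hoff m l hm.1 hm.2 hl.1 hl.2 hlm.symm, sub_self]
  have h2 : ∑ m ∈ R, (Q j m + Q m i + Q m m) = ∑ m ∈ R, (Q' i m + Q' m j + Q' m m) :=
    Finset.sum_congr rfl fun m hm => hdiag m ((hRm m).1 hm).1 ((hRm m).1 hm).2
  simp only [Finset.sum_sub_distrib, Finset.sum_add_distrib] at h1 h2
  rw [Finset.sum_comm (f := fun m l => Q' l m)] at h1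
  linear_combination h0 + h1 + h2

/-- second order terms -/
noncomputable def edQ (τ : ℂ) (lam : Fin n → ℂ) (F : (Fin n → ℂ) → ℂ) (x : Fin n → ℂ)
    (i j m l : Fin n) : ℂ :=
  sigmaFn τ (lam i - lam m) (x i - x m) * (sigmaFn τ (lam j - lam l)
    ((x ∘ Equiv.swap i m) j - (x ∘ Equiv.swap i m) l) * F ((x ∘ Equiv.swap i m) ∘ Equiv.swap j l))

lemma ed_fayQ (hτ : 0 < τ.im)
    (hlam : ∀ i j : Fin n, i ≠ j → lam i - lam j ∉ lat τ)
    {x : Fin n → ℂ} (hx : x ∈ Ugrid n τ) (i j m : Fin n) (hij : i ≠ j) (him : m ≠ i) (hjm : m ≠ j) :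
    edQ τ lam F x i j m i + edQ τ lam F x i j j m = edQ τ lam F x j i m m := by
  have e1 : (x ∘ Equiv.swap i m) ∘ Equiv.swap j i = (x ∘ Equiv.swap j m) ∘ Equiv.swap i m := by
    funext l
    simp only [Function.comp, Equiv.swap_apply_def]
    congr 1
    grind
  have e2 : (x ∘ Equiv.swap i j) ∘ Equiv.swap j m = (x ∘ Equiv.swap j m) ∘ Equiv.swap i m := by
    funext l
    simp only [Function.comp, Equiv.swap_apply_def]
    congr 1
    grind
  have f := ed_fay τ hτ (x i - x j) (x j - x m) (lam i - lam j) (lam j - lam m)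
    (hx i j hij) (hx j m hjm.symm) (by simpa using hx i m him.symm)
    (hlam i j hij) (hlam j m hjm.symm) (by simpa using hlam i m him.symm)
  simp only [sub_add_sub_cancel, neg_sub] at f
  unfold edQ
  rw [e1, e2]
  simp only [Function.comp, Equiv.swap_apply_left, Equiv.swap_apply_right,
    Equiv.swap_apply_of_ne_of_ne hij.symm hjm.symm, Equiv.swap_apply_of_ne_of_ne him hjm,
    Equiv.swap_apply_of_ne_of_ne hij him.symm]
  linear_combination F ((x ∘ Equiv.swap j m) ∘ Equiv.swap i m) * f

lemma ed_sigma_swap (τ a b y z : ℂ) : sigmaFn τ (b - a) (z - y) = - sigmaFn τ (a - b) (y - z) := by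
  rw [← ed_sigma_neg, neg_sub, neg_sub]

lemma ed_dsigma_swap (τ a b y z : ℂ) :
    deriv (sigmaFn τ (b - a)) (z - y) = deriv (sigmaFn τ (a - b)) (y - z) := by
  have h : sigmaFn τ (b - a) = fun w => -(sigmaFn τ (a - b) (-w)) := by
    funext w
    rw [← ed_sigma_neg, neg_sub, neg_neg]
  rw [h, deriv.fun_neg, deriv_comp_neg, neg_neg, neg_sub]

lemma ed_expand (hτ : 0 < τ.im)
    (hlam : ∀ i j : Fin n, i ≠ j → lam i - lam j ∉ lat τ)
    (hF : DifferentiableOn ℂ F (Ugrid n τ))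
    {x : Fin n → ℂ} (hx : x ∈ Ugrid n τ) (i j : Fin n) :
    ellDunkl n τ k lam i (ellDunkl n τ k lam j F) x =
      fderiv ℂ (fun y => fderiv ℂ F y (Pi.single j 1)) x (Pi.single i 1) +
        k * ∑ l ∈ Finset.univ.filter (fun l => l ≠ j),
      (sigmaFn τ (lam j - lam l) (x j - x l) *
          (fderiv ℂ F (x ∘ Equiv.swap j l) (Pi.single (Equiv.swap j l i) 1)) +
        F (x ∘ Equiv.swap j l) * (deriv (sigmaFn τ (lam j - lam l)) (x j - x l) *
          ((Pi.single i 1 : Fin n → ℂ) j - (Pi.single i 1 : Fin n → ℂ) l))) +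
      k * ∑ m ∈ Finset.univ.filter (fun m => m ≠ i), sigmaFn τ (lam i - lam m) (x i - x m) *
        fderiv ℂ F (x ∘ Equiv.swap i m) (Pi.single j 1) +
      k ^ 2 * ∑ m ∈ Finset.univ.filter (fun m => m ≠ i),
        ∑ l ∈ Finset.univ.filter (fun l => l ≠ j), edQ τ lam F x i j m l := by
  conv_lhs => rw [ellDunkl, ed_fderiv_apply k hτ hlam hF hx i j]
  rw [add_assoc (_ + _)]
  congr 1
  rw [pow_two, mul_assoc, ← mul_add]
  congr 1
  rw [Finset.mul_sum, ← Finset.sum_add_distrib]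
  refine Finset.sum_congr rfl fun m _ => ?_
  rw [ellDunkl, mul_add]
  congr 1
  rw [mul_left_comm, Finset.mul_sum]
  rfl

lemma ed_comm (hτ : 0 < τ.im)
    (hlam : ∀ i j : Fin n, i ≠ j → lam i - lam j ∉ lat τ)
    (hF : DifferentiableOn ℂ F (Ugrid n τ))
    {x : Fin n → ℂ} (hx : x ∈ Ugrid n τ) (i j : Fin n) (hij : i ≠ j) :
    ellDunkl n τ k lam i (ellDunkl n τ k lam j F) x =
      ellDunkl n τ k lam j (ellDunkl n τ k lam i F) x := by
  rw [ed_expand k hτ hlam hF hx, ed_expand k hτ hlam hF hx]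
  have hQ : ∑ m ∈ Finset.univ.filter (fun m => m ≠ i),
      ∑ l ∈ Finset.univ.filter (fun l => l ≠ j), edQ τ lam F x i j m l =
      ∑ m ∈ Finset.univ.filter (fun m => m ≠ j),
      ∑ l ∈ Finset.univ.filter (fun l => l ≠ i), edQ τ lam F x j i m l := by
    apply ed_sumQ i j hij
    · unfold edQ
      rw [Equiv.swap_comm j i]
      simp only [Function.comp, Equiv.swap_apply_left, Equiv.swap_apply_right]
      rw [ed_sigma_swap τ (lam i) (lam j) (x i) (x j), ed_sigma_swap τ (lam i) (lam j) (x j) (x i)]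
      ring
    · intro m l h1 h2 h3 h4 h5
      unfold edQ
      have e : (x ∘ Equiv.swap i m) ∘ Equiv.swap j l = (x ∘ Equiv.swap j l) ∘ Equiv.swap i m := by
        funext t
        simp only [Function.comp, Equiv.swap_apply_def]
        congr 1
        grind
      rw [e]
      simp only [Function.comp, Equiv.swap_apply_of_ne_of_ne hij.symm h2.symm,
        Equiv.swap_apply_of_ne_of_ne h3 h5.symm, Equiv.swap_apply_of_ne_of_ne hij h3.symm,
        Equiv.swap_apply_of_ne_of_ne h2 h5]
      ring
    · intro m h1 h2
      have a1 := ed_fayQ (F := F) hτ hlam hx i j m hij h1 h2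
      have a2 := ed_fayQ (F := F) hτ hlam hx j i m hij.symm h2 h1
      linear_combination a1 - a2
  rw [hQ, ed_symm (ed_open n τ hτ) hF hx (Pi.single j 1) (Pi.single i 1)]
  have key : ∀ i j : Fin n, i ≠ j →
      ∑ l ∈ Finset.univ.filter (fun l => l ≠ i ∧ l ≠ j),
      (sigmaFn τ (lam j - lam l) (x j - x l) *
          (fderiv ℂ F (x ∘ Equiv.swap j l) (Pi.single (Equiv.swap j l i) 1)) +
        F (x ∘ Equiv.swap j l) * (deriv (sigmaFn τ (lam j - lam l)) (x j - x l) *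
          ((Pi.single i 1 : Fin n → ℂ) j - (Pi.single i 1 : Fin n → ℂ) l))) =
      ∑ l ∈ Finset.univ.filter (fun l => l ≠ i ∧ l ≠ j), sigmaFn τ (lam j - lam l) (x j - x l) *
        fderiv ℂ F (x ∘ Equiv.swap j l) (Pi.single i 1) := by
    intro i j hij
    refine Finset.sum_congr rfl fun l hl => ?_
    simp only [Finset.mem_filter, Finset.mem_univ, true_and] at hl
    rw [Equiv.swap_apply_of_ne_of_ne hij hl.1.symm]
    simp [hij.symm, hl.1]
  have k1 := key i j hij
  have k2 := key j i hij.symm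
  simp only [and_comm (a := _ ≠ j)] at k2
  simp only [ed_split i j hij, ed_split' i j hij]
  rw [k1, k2, Equiv.swap_comm j i, ed_sigma_swap τ (lam i) (lam j) (x i) (x j),
    ed_dsigma_swap τ (lam i) (lam j) (x i) (x j)]
  simp only [Equiv.swap_apply_left, Equiv.swap_apply_right, Pi.single_eq_same,
    Pi.single_eq_of_ne hij, Pi.single_eq_of_ne hij.symm]
  ring

lemma ed_shift (hτ : 0 < τ.im)
    (htrans : ∀ x ∈ Ugrid n τ, ∀ a : ℂ, F (fun i => x i + a) = F x)
    {x : Fin n → ℂ} (hx : x ∈ Ugrid n τ) (a : ℂ) (i : Fin n) :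
    ellDunkl n τ k lam i F (fun l => x l + a) = ellDunkl n τ k lam i F x := by
  have h1 : fderiv ℂ F (fun l => x l + a) = fderiv ℂ F x := by
    have e : (fun l => x l + a) = x + (fun _ => a) := rfl
    rw [e, ← fderiv_comp_add_right]
    apply Filter.EventuallyEq.fderiv_eq
    filter_upwards [(ed_open n τ hτ).mem_nhds hx] with y hy
    exact htrans y hy a
  unfold ellDunkl
  rw [h1]
  congr 2
  refine Finset.sum_congr rfl fun j _ => ?_
  rw [add_sub_add_right_eq_sub]
  congr 1
  exact htrans _ (ed_perm_mem hx _) a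

end

theorem elliptic_dunkl_commute
    (n : ℕ) (hn : 2 ≤ n) (τ : ℂ) (hτ : 0 < τ.im) (k : ℂ)
    (lam : Fin n → ℂ) (hlam : ∀ i j : Fin n, i ≠ j → lam i - lam j ∉ lat τ)
    (F : (Fin n → ℂ) → ℂ)
    (hF : DifferentiableOn ℂ F (Ugrid n τ))
    (htrans : ∀ x ∈ Ugrid n τ, ∀ a : ℂ, F (fun i => x i + a) = F x) :
    (∀ i : Fin n,
      DifferentiableOn ℂ (ellDunkl n τ k lam i F) (Ugrid n τ) ∧
      ∀ x ∈ Ugrid n τ, ∀ a : ℂ,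
        ellDunkl n τ k lam i F (fun l => x l + a) = ellDunkl n τ k lam i F x) ∧
    ∀ i j : Fin n, ∀ x ∈ Ugrid n τ,
      ellDunkl n τ k lam i (ellDunkl n τ k lam j F) x
        = ellDunkl n τ k lam j (ellDunkl n τ k lam i F) x := by

  refine ⟨fun i => ⟨fun x hx => ?_, fun x hx a => ed_shift k hτ htrans hx a i⟩, fun i j x hx => ?_⟩
  · exact (ed_hasFDerivAt k hτ hlam hF hx i).differentiableAt.differentiableWithinAt
  · by_cases hij : i = j
    · rw [hij]
    · exact ed_comm k hτ hlam hF hx i j hij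
end
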